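/- Let N ≥ 1, β ∈ LP_N, and j ∈ {1,…,2N−1} with {j,j+1} ∉ β. Fix the coordinates x_1 < ⋯ < x_{j−1} and x_{j+2} < ⋯ < x_{2N}, and let ξ ∈ (x_{j−1}, x_{j+2}). Then, as x_j, x_{j+1} → ξ, the quotient F_β(x_1,…,x_{2N}) / ((x_{j+1} − x_j)^{1/4} · |log(x_{j+1} − x_j)|) converges to F_{℘_j(β)/{j,j+1}}(x_1,…,x_{j−1},x_{j+2},…,x_{2N}). -/

import Mathlib

open MeasureTheory

/-- A planar link pattern of size `N`: a noncrossing perfect matching of `{1,…,2N}`,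
with the links `{a r, b r}` satisfying `a r < b r` and `a` strictly increasing. -/
structure LinkPattern (N : ℕ) where
  a : Fin N → ℕ
  b : Fin N → ℕ
  a_lt_b : ∀ r, a r < b r
  a_mono : StrictMono a
  inj : Function.Injective (fun p : Fin N × Bool => if p.2 then b p.1 else a p.1)
  cover : ∀ k : ℕ, (∃ p : Fin N × Bool, (if p.2 then b p.1 else a p.1) = k) ↔ (1 ≤ k ∧ k ≤ 2 * N)
  noncross : ∀ r s : Fin N, ¬ (a r < a s ∧ a s < b r ∧ b r < b s)

/-- The (unordered) link relation of a link pattern. -/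
def LinkPattern.Linked {N : ℕ} (β : LinkPattern N) (p q : ℕ) : Prop :=
  ∃ r, (β.a r = p ∧ β.b r = q) ∨ (β.a r = q ∧ β.b r = p)

/-- The positive real integral `ρ_{k_1,…,k_N}(x)`. -/
noncomputable def rho (N : ℕ) (k : Fin N → ℕ) (x : ℕ → ℝ) : ℝ :=
  (∏ p ∈ (Finset.Icc 1 (2 * N) ×ˢ Finset.Icc 1 (2 * N)).filter fun p => p.1 < p.2,
      (x p.2 - x p.1) ^ ((4 : ℝ)⁻¹)) *
  ∫ u : Fin N → ℝ in Set.univ.pi fun r => Set.Ioo (x (k r)) (x (k r + 1)),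
    (∏ p ∈ (Finset.univ ×ˢ Finset.univ : Finset (Fin N × Fin N)).filter fun p => p.1 < p.2,
        (u p.2 - u p.1)) *
      ∏ r, ∏ i ∈ Finset.Icc 1 (2 * N), |u r - x i| ^ (-(2 : ℝ)⁻¹)

/-- The coefficient `c_β(k_1,…,k_N)`. -/
noncomputable def linkCoeff (N : ℕ) (β : LinkPattern N) (k : Fin N → ℕ) : ℂ :=
  Complex.I ^ ((∑ r, (k r : ℤ)) - ∑ r, (β.a r : ℤ)) *
    ∑ σ : Equiv.Perm (Fin N),
      ((Equiv.Perm.sign σ : ℤ) : ℂ) *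
        ∏ r, if β.a r ≤ k (σ r) ∧ k (σ r) < β.b r then (1 : ℂ) else 0

/-- The Coulomb gas integral `F_β(x)`. -/
noncomputable def coulomb (N : ℕ) (β : LinkPattern N) (x : ℕ → ℝ) : ℂ :=
  ∑ k ∈ (Fintype.piFinset fun _ : Fin N => Finset.Icc 1 (2 * N - 1)).filter
      fun k => ∀ r s : Fin N, r < s → k r < k s,
    linkCoeff N β k * (rho N k x : ℂ)

/-- Membership in the open chamber `𝔛_{2N}` (only coordinates `1,…,2N` are relevant). -/
def IsChamber (N : ℕ) (x : ℕ → ℝ) : Prop :=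
  ∀ i k : ℕ, 1 ≤ i → i < k → k ≤ 2 * N → x i < x k

/-- The relabeling map `{1,…,2N}∖{j,j+1} → {1,…,2N−2}`: `k ↦ k` for `k < j`, `k ↦ k−2` for `k > j+1`. -/
def relabelIdx (j k : ℕ) : ℕ := if k < j then k else k - 2

/-- `γ ∈ LP_{N−1}` is the pattern `β/{j,j+1}` obtained from `β ∈ LP_N` by deleting the link
`{j,j+1}` and relabeling the remaining indices in increasing order. -/
def IsReduction (N : ℕ) (β : LinkPattern N) (j : ℕ) (γ : LinkPattern (N - 1)) : Prop :=
  ∀ p q : ℕ, γ.Linked p q ↔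
    ∃ p' q', β.Linked p' q' ∧ p' ≠ j ∧ p' ≠ j + 1 ∧ q' ≠ j ∧ q' ≠ j + 1 ∧
      p = relabelIdx j p' ∧ q = relabelIdx j q'

/-- `δ ∈ LP_{N−1}` is the pattern `℘_j(β)/{j,j+1}` obtained from `β ∈ LP_N` (with `{j,j+1} ∉ β`,
partners `ℓ₁` of `j` and `ℓ₂` of `j+1`) by removing the links `{j,ℓ₁}`, `{j+1,ℓ₂}`, adding the
link `{ℓ₁,ℓ₂}`, removing the link `{j,j+1}` and relabeling the remaining indices. -/
def IsTieReduction (N : ℕ) (β : LinkPattern N) (j : ℕ) (δ : LinkPattern (N - 1)) : Prop :=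
  ∃ l1 l2 : ℕ, β.Linked j l1 ∧ β.Linked (j + 1) l2 ∧
    ∀ p q : ℕ, δ.Linked p q ↔
      ((∃ p' q', β.Linked p' q' ∧ p' ≠ j ∧ p' ≠ j + 1 ∧ q' ≠ j ∧ q' ≠ j + 1 ∧
          p = relabelIdx j p' ∧ q = relabelIdx j q') ∨
        (p = relabelIdx j l1 ∧ q = relabelIdx j l2) ∨
        (p = relabelIdx j l2 ∧ q = relabelIdx j l1))

/-- **Cauchy–Binet formula**, with the minors indexed by strictly increasing tuples. -/
theorem det_sum_eq_sum_strictMono {n : ℕ} (K : Finset ℕ) (A : Fin n → ℕ → ℂ)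
    (B : ℕ → Fin n → ℂ) :
    Matrix.det (Matrix.of fun r c => ∑ k ∈ K, A r k * B k c) =
      ∑ k ∈ (Fintype.piFinset fun _ : Fin n => K).filter
          fun k => ∀ r s : Fin n, r < s → k r < k s,
        (∑ σ : Equiv.Perm (Fin n), ((Equiv.Perm.sign σ : ℤ) : ℂ) * ∏ r, A r (k (σ r))) *
          Matrix.det (Matrix.of fun r c => B (k r) c) := by
  have h1 : Matrix.det (Matrix.of fun r c => ∑ k ∈ K, A r k * B k c) =
      ∑ f ∈ Fintype.piFinset fun _ : Fin n => K,
        (∏ r, A r (f r)) * Matrix.det (Matrix.of fun r c => B (f r) c) := by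
    have e1 : (Matrix.of fun r c => ∑ k ∈ K, A r k * B k c) =
        fun r => ∑ k ∈ K, A r k • B k := by
      ext r c
      simp [Finset.sum_apply]
    rw [e1]
    have := (Matrix.detRowAlternating (R := ℂ) (n := Fin n)).toMultilinearMap.map_sum_finset
      (fun r k => A r k • B k) (fun _ => K)
    refine this.trans (Finset.sum_congr rfl fun f _ => ?_)
    exact (Matrix.detRowAlternating (R := ℂ) (n := Fin n)).toMultilinearMap.map_smul_univ
      (fun r => A r (f r)) (fun r => B (f r))
  rw [h1]
  symm
  have h2 : ∀ k : Fin n → ℕ, ∀ σ : Equiv.Perm (Fin n),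
      Matrix.det (Matrix.of fun r c => B (k (σ r)) c) =
        ((Equiv.Perm.sign σ : ℤ) : ℂ) * Matrix.det (Matrix.of fun r c => B (k r) c) := by
    intro k σ
    exact Matrix.det_permute σ (Matrix.of fun r c => B (k r) c)
  have h3 : ∀ k : Fin n → ℕ,
      (∑ σ : Equiv.Perm (Fin n), ((Equiv.Perm.sign σ : ℤ) : ℂ) * ∏ r, A r (k (σ r))) *
          Matrix.det (Matrix.of fun r c => B (k r) c) =
      ∑ σ : Equiv.Perm (Fin n), (∏ r, A r (k (σ r))) *
        Matrix.det (Matrix.of fun r c => B (k (σ r)) c) := by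
    intro k
    rw [Finset.sum_mul]
    refine Finset.sum_congr rfl fun σ _ => ?_
    rw [h2]
    ring
  simp_rw [h3]
  rw [← Finset.sum_product']
  rw [← Finset.sum_filter_of_ne (s := Fintype.piFinset fun _ : Fin n => K)
    (p := fun f => Function.Injective f)]
  · refine Finset.sum_bij (fun p _ => p.1 ∘ p.2) ?_ ?_ ?_ ?_
    · rintro ⟨k, σ⟩ h
      simp only [Finset.mem_product, Finset.mem_filter, Fintype.mem_piFinset, Finset.mem_univ,
        and_true] at h
      simp only [Finset.mem_filter, Fintype.mem_piFinset, Function.comp_apply]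
      refine ⟨fun a => h.1 _, ?_⟩
      exact (StrictMono.injective fun r s hrs => h.2 r s hrs).comp σ.injective
    · rintro ⟨k, σ⟩ h ⟨k', σ'⟩ h' heq
      simp only [Finset.mem_product, Finset.mem_filter, Fintype.mem_piFinset, Finset.mem_univ,
        and_true] at h h'
      have hk : StrictMono k := fun r s hrs => h.2 r s hrs
      have hk' : StrictMono k' := fun r s hrs => h'.2 r s hrs
      have hkk : k = k' := by
        rw [← hk.range_inj hk']
        rw [← σ.surjective.range_comp k, ← σ'.surjective.range_comp k']
        exact congrArg Set.range heq
      subst hkk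
      congr 1
      ext r
      have := congrFun heq r
      simp only [Function.comp_apply] at this
      rw [hk.injective this]
    · intro f hf
      simp only [Finset.mem_filter, Fintype.mem_piFinset] at hf
      refine ⟨(f ∘ Tuple.sort f, (Tuple.sort f)⁻¹), ?_, ?_⟩
      · simp only [Finset.mem_product, Finset.mem_filter, Fintype.mem_piFinset, Finset.mem_univ,
          and_true, Function.comp_apply]
        refine ⟨fun a => hf.1 _, fun r s hrs => ?_⟩
        exact (Tuple.monotone_sort f).strictMono_of_injective
          (hf.2.comp (Tuple.sort f).injective) hrs
      · ext r
        simp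
    · rintro ⟨k, σ⟩ _
      rfl
  · intro f _ hne r s hrs
    by_contra hne'
    apply hne
    rw [Matrix.det_zero_of_row_eq hne', mul_zero]
    ext c
    simp [hrs]

/-- **Andréief identity** on a product of intervals, for a monic polynomial basis. -/
theorem integral_vandermonde_mul_prod {n : ℕ} (I : Fin n → Set ℝ) (w : ℝ → ℝ)
    (P : Fin n → Polynomial ℝ) (hdeg : ∀ i, (P i).natDegree = i) (hmonic : ∀ i, (P i).Monic)
    (hint : ∀ r c, IntegrableOn (fun u => (P c).eval u * w u) (I r)) :
    ∫ u : Fin n → ℝ in Set.univ.pi I,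
      (∏ p ∈ (Finset.univ ×ˢ Finset.univ : Finset (Fin n × Fin n)).filter fun p => p.1 < p.2,
        (u p.2 - u p.1)) * ∏ r, w (u r) =
      Matrix.det (Matrix.of fun r c => ∫ u in I r, (P c).eval u * w u) := by
  have hV : ∀ u : Fin n → ℝ,
      (∏ p ∈ (Finset.univ ×ˢ Finset.univ : Finset (Fin n × Fin n)).filter fun p => p.1 < p.2,
        (u p.2 - u p.1)) * ∏ r, w (u r) =
      ∑ σ : Equiv.Perm (Fin n), ((Equiv.Perm.sign σ : ℤ) : ℝ) *
        ∏ r, ((P (σ⁻¹ r)).eval (u r) * w (u r)) := by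
    intro u
    have e : (∏ p ∈ (Finset.univ ×ˢ Finset.univ : Finset (Fin n × Fin n)).filter
        fun p => p.1 < p.2, (u p.2 - u p.1)) = (Matrix.vandermonde u).det := by
      rw [Matrix.det_vandermonde, Finset.prod_filter, Finset.prod_product]
      refine Finset.prod_congr rfl fun i _ => ?_
      rw [← Finset.prod_filter]
      refine Finset.prod_congr ?_ fun _ _ => rfl
      ext; simp
    rw [e, Matrix.det_eval_matrixOfPolynomials_eq_det_vandermonde u P hdeg hmonic,
      Matrix.det_apply', Finset.sum_mul]
    refine Finset.sum_congr rfl fun σ _ => ?_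
    rw [mul_assoc]
    congr 1
    rw [Finset.prod_mul_distrib]
    congr 1
    rw [← Equiv.prod_comp σ fun r => (P (σ⁻¹ r)).eval (u r)]
    simp
  simp_rw [hV]
  have hm : (volume : Measure (Fin n → ℝ)).restrict (Set.univ.pi I) =
      Measure.pi fun r => (volume : Measure ℝ).restrict (I r) := by
    rw [volume_pi, Measure.restrict_pi_pi]
  rw [hm, integral_finsetSum]
  · rw [Matrix.det_apply']
    refine Finset.sum_congr rfl fun σ _ => ?_
    rw [integral_const_mul, integral_fintype_prod_eq_prod
      (f := fun r (u : ℝ) => (P (σ⁻¹ r)).eval u * w u)]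
    congr 1
    rw [← Equiv.prod_comp σ fun r => ∫ u in I r, (P (σ⁻¹ r)).eval u * w u]
    simp
  · intro σ _
    refine Integrable.const_mul ?_ _
    exact Integrable.fintype_prod (f := fun r (u : ℝ) => (P (σ⁻¹ r)).eval u * w u)
      fun r => hint r _

theorem locallyIntegrable_abs_sub_rpow (a : ℝ) :
    LocallyIntegrable (fun u : ℝ => |u - a| ^ (-(2 : ℝ)⁻¹)) := by
  have h0 : LocallyIntegrable (fun u : ℝ => |u| ^ (-(2 : ℝ)⁻¹)) := by
    refine locallyIntegrable_of_norm_le_rpow (E := ℝ) (C := 1) (α := (2 : ℝ)⁻¹) (by simp) ?_ ?_ ?_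
    · simp only [Module.finrank_self, Nat.cast_one]; norm_num
    · refine Filter.Eventually.of_forall fun u => ?_
      simp only [Real.norm_eq_abs, one_mul]
      rw [abs_of_nonneg (by positivity)]
    · exact (by fun_prop : Measurable fun u : ℝ => |u| ^ (-(2 : ℝ)⁻¹)).aestronglyMeasurable
  have := (locallyIntegrable_map_homeomorph (Homeomorph.subRight a)
    (f := fun u : ℝ => |u| ^ (-(2 : ℝ)⁻¹)) (μ := volume)).1
  have hm : Measure.map (Homeomorph.subRight a) (volume : Measure ℝ) = volume :=
    (measurePreserving_sub_right volume a).map_eq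
  rw [hm] at this
  exact this h0

theorem continuousAt_prod_abs_sub_rpow {ι : Type*} (T : Finset ι) (y : ι → ℝ) (u₀ : ℝ)
    (h : ∀ i ∈ T, y i ≠ u₀) :
    ContinuousAt (fun u : ℝ => ∏ i ∈ T, |u - y i| ^ (-(2 : ℝ)⁻¹)) u₀ := by
  refine tendsto_finsetProd _ fun i hi => ?_
  refine ContinuousAt.rpow_const (by fun_prop) (Or.inl ?_)
  exact (abs_pos.2 (sub_ne_zero.2 (h i hi).symm)).ne'

/-- A product of inverse square-root singularities at distinct points is locally integrable. -/
theorem locallyIntegrable_prod_abs_sub_rpow {ι : Type*} (T : Finset ι) (y : ι → ℝ)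
    (hy : Set.InjOn y T) :
    LocallyIntegrable (fun u : ℝ => ∏ i ∈ T, |u - y i| ^ (-(2 : ℝ)⁻¹)) := by
  classical
  intro u₀
  have hmeas : StronglyMeasurableAtFilter (fun u : ℝ => ∏ i ∈ T, |u - y i| ^ (-(2 : ℝ)⁻¹))
      (nhds u₀) :=
    (by fun_prop : Measurable fun u : ℝ => ∏ i ∈ T, |u - y i| ^ (-(2 : ℝ)⁻¹))
      |>.stronglyMeasurable.aestronglyMeasurable.stronglyMeasurableAtFilter
  by_cases h : ∃ i ∈ T, y i = u₀
  · obtain ⟨i, hi, rfl⟩ := h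
    have hc : ContinuousAt (fun u : ℝ => ∏ l ∈ T.erase i, |u - y l| ^ (-(2 : ℝ)⁻¹)) (y i) :=
      continuousAt_prod_abs_sub_rpow _ _ _ fun l hl hli =>
        (Finset.mem_erase.1 hl).1 (hy (Finset.mem_erase.1 hl).2 hi hli)
    have hO : (fun u : ℝ => ∏ i ∈ T, |u - y i| ^ (-(2 : ℝ)⁻¹)) =O[nhds (y i)]
        fun u => |u - y i| ^ (-(2 : ℝ)⁻¹) := by
      have := (Asymptotics.isBigO_refl (fun u => |u - y i| ^ (-(2 : ℝ)⁻¹)) (nhds (y i))).mul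
        (hc.tendsto.isBigO_one ℝ)
      refine Asymptotics.IsBigO.congr this (fun u => ?_) fun u => mul_one _
      exact Finset.mul_prod_erase T (fun l => |u - y l| ^ (-(2 : ℝ)⁻¹)) hi
    exact hO.integrableAtFilter hmeas (locallyIntegrable_abs_sub_rpow (y i) (y i))
  · push Not at h
    have hc := continuousAt_prod_abs_sub_rpow T y u₀ h
    exact (hc.tendsto.isBigO_one ℝ).integrableAtFilter hmeas
      ((locallyIntegrable_const (1 : ℝ)) u₀)

/-- The prefactor `∏ (x_j - x_i)^{1/4}`. -/
noncomputable def coulombPrefactor (N : ℕ) (x : ℕ → ℝ) : ℝ :=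
  ∏ p ∈ (Finset.Icc 1 (2 * N) ×ˢ Finset.Icc 1 (2 * N)).filter fun p => p.1 < p.2,
      (x p.2 - x p.1) ^ ((4 : ℝ)⁻¹)

theorem IsChamber.injOn {N : ℕ} {x : ℕ → ℝ} (hx : IsChamber N x) :
    Set.InjOn x (Finset.Icc 1 (2 * N) : Finset ℕ) := by
  intro i hi k hk h
  simp only [Finset.coe_Icc, Set.mem_Icc] at hi hk
  rcases lt_trichotomy i k with hlt | rfl | hlt
  · exact absurd h (hx i k hi.1 hlt hk.2).ne
  · rfl
  · exact absurd h (hx k i hk.1 hlt hi.2).ne'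

theorem rho_eq_det {N : ℕ} (k : Fin N → ℕ) {x : ℕ → ℝ} (hx : IsChamber N x)
    (P : Fin N → Polynomial ℝ) (hdeg : ∀ i, (P i).natDegree = i) (hmonic : ∀ i, (P i).Monic) :
    rho N k x = coulombPrefactor N x * Matrix.det (Matrix.of fun r c =>
      ∫ u in Set.Ioo (x (k r)) (x (k r + 1)),
        (P c).eval u * ∏ i ∈ Finset.Icc 1 (2 * N), |u - x i| ^ (-(2 : ℝ)⁻¹)) := by
  rw [rho, coulombPrefactor]
  congr 1
  refine integral_vandermonde_mul_prod _
    (fun u => ∏ i ∈ Finset.Icc 1 (2 * N), |u - x i| ^ (-(2 : ℝ)⁻¹)) P hdeg hmonic fun r c => ?_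
  have h := (locallyIntegrable_prod_abs_sub_rpow _ x hx.injOn).integrableOn_isCompact
    (isCompact_Icc (a := x (k r)) (b := x (k r + 1)))
  exact (h.continuousOn_mul (P c).continuous.continuousOn isCompact_Icc).mono_set
    Set.Ioo_subset_Icc_self

/-- The Coulomb gas integral is a single determinant of one-dimensional integrals. -/
theorem coulomb_eq_det {N : ℕ} (β : LinkPattern N) {x : ℕ → ℝ} (hx : IsChamber N x)
    (P : Fin N → Polynomial ℝ) (hdeg : ∀ i, (P i).natDegree = i) (hmonic : ∀ i, (P i).Monic) :
    coulomb N β x = (coulombPrefactor N x : ℂ) * (Complex.I ^ (-∑ r, (β.a r : ℤ)) *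
      Matrix.det (Matrix.of fun r c => ∑ k ∈ Finset.Icc 1 (2 * N - 1),
        (if β.a r ≤ k ∧ k < β.b r then Complex.I ^ k else 0) *
        ((∫ u in Set.Ioo (x k) (x (k + 1)),
          (P c).eval u * ∏ i ∈ Finset.Icc 1 (2 * N), |u - x i| ^ (-(2 : ℝ)⁻¹) : ℝ) : ℂ))) := by
  rw [det_sum_eq_sum_strictMono, coulomb, Finset.mul_sum, Finset.mul_sum]
  refine Finset.sum_congr rfl fun k _ => ?_
  rw [rho_eq_det k hx P hdeg hmonic, linkCoeff]
  have hdet : (Matrix.det (Matrix.of fun (r c : Fin N) =>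
      ((∫ u in Set.Ioo (x (k r)) (x (k r + 1)),
        (P c).eval u * ∏ i ∈ Finset.Icc 1 (2 * N), |u - x i| ^ (-(2 : ℝ)⁻¹) : ℝ) : ℂ))) =
      ((Matrix.det (Matrix.of fun (r c : Fin N) =>
      ∫ u in Set.Ioo (x (k r)) (x (k r + 1)),
        (P c).eval u * ∏ i ∈ Finset.Icc 1 (2 * N), |u - x i| ^ (-(2 : ℝ)⁻¹)) : ℝ) : ℂ) := by
    rw [← Complex.ofRealHom_eq_coe, RingHom.map_det]
    rfl
  rw [hdet, sub_eq_add_neg, zpow_add₀ Complex.I_ne_zero]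
  have hprod : ∀ σ : Equiv.Perm (Fin N),
      (∏ r, if β.a r ≤ k (σ r) ∧ k (σ r) < β.b r then Complex.I ^ k (σ r) else 0) =
        Complex.I ^ (∑ r, (k r : ℤ)) *
          ∏ r, if β.a r ≤ k (σ r) ∧ k (σ r) < β.b r then (1 : ℂ) else 0 := by
    intro σ
    rw [← Equiv.sum_comp σ]
    have : Complex.I ^ (∑ r, (k (σ r) : ℤ)) = ∏ r, Complex.I ^ (k (σ r)) := by
      rw [← Nat.cast_sum, zpow_natCast, Finset.prod_pow_eq_pow_sum]
    rw [this, ← Finset.prod_mul_distrib]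
    refine Finset.prod_congr rfl fun r _ => ?_
    split_ifs <;> simp
  simp_rw [hprod]
  push_cast
  simp only [mul_left_comm (_ : ℂ) (Complex.I ^ (∑ r, (k r : ℤ)))]
  rw [← Finset.mul_sum]
  ring

theorem abs_rpow_neg_half (v : ℝ) : |v| ^ (-(2 : ℝ)⁻¹) = (√|v|)⁻¹ := by
  rw [Real.rpow_neg (abs_nonneg v), Real.sqrt_eq_rpow, one_div]

/-- The weight with inverse square-root singularities at `s` and `t`. -/
noncomputable def pairWeight (s t u : ℝ) : ℝ := |u - s| ^ (-(2 : ℝ)⁻¹) * |u - t| ^ (-(2 : ℝ)⁻¹)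

theorem pairWeight_nonneg (s t u : ℝ) : 0 ≤ pairWeight s t u := by
  unfold pairWeight; positivity

theorem measurable_pairWeight (s t : ℝ) : Measurable (pairWeight s t) := by
  unfold pairWeight; fun_prop

theorem pairWeight_eq (s t u : ℝ) : pairWeight s t u = (√|u - s|)⁻¹ * (√|u - t|)⁻¹ := by
  simp only [pairWeight, abs_rpow_neg_half]

theorem abs_sqrt_sub_sqrt_le (X Y : ℝ) (hX : 0 ≤ X) (hY : 0 ≤ Y) :
    |√X - √Y| ≤ √|X - Y| := by
  refine Real.le_sqrt_of_sq_le ?_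
  rw [sq_abs]
  have h1 := Real.sqrt_nonneg X
  have h2 := Real.sqrt_nonneg Y
  have h3 := Real.sq_sqrt hX
  have h4 := Real.sq_sqrt hY
  rcases le_total (√X) (√Y) with h | h
  · have : X ≤ Y := by nlinarith
    rw [abs_of_nonpos (by linarith)]; nlinarith
  · have : Y ≤ X := by nlinarith
    rw [abs_of_nonneg (by linarith)]; nlinarith

theorem sub_mul_pairWeight_left {s t u : ℝ} (hst : s < t) (hu : u < s) :
    |(u - s) * pairWeight s t u - (-1)| ≤ √(t - s) * |u - t| ^ (-(2 : ℝ)⁻¹) := by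
  rw [pairWeight_eq, abs_rpow_neg_half, abs_of_neg (by linarith : u - s < 0),
    abs_of_neg (by linarith : u - t < 0)]
  have hX : 0 < √(-(u - s)) := Real.sqrt_pos.2 (by linarith)
  have hY : 0 < √(-(u - t)) := Real.sqrt_pos.2 (by linarith)
  have hXs := Real.mul_self_sqrt (by linarith : 0 ≤ -(u - s))
  have h := abs_sqrt_sub_sqrt_le (-(u - s)) (-(u - t)) (by linarith) (by linarith)
  rw [show |-(u - s) - -(u - t)| = t - s by
    rw [show -(u - s) - -(u - t) = -(t - s) by ring, abs_neg, abs_of_pos (by linarith)]] at h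
  have e : (u - s) * ((√(-(u - s)))⁻¹ * (√(-(u - t)))⁻¹) - (-1) =
      -(√(-(u - s)) - √(-(u - t))) * (√(-(u - t)))⁻¹ := by
    have h0 : u - s = -(√(-(u - s)) * √(-(u - s))) := by rw [hXs]; ring
    nth_rewrite 1 [h0]
    field_simp
    ring
  rw [e, abs_mul, abs_neg, abs_of_pos (inv_pos.2 hY)]
  gcongr

theorem sub_mul_pairWeight_right {s t u : ℝ} (hst : s < t) (hu : t < u) :
    |(u - s) * pairWeight s t u - 1| ≤ √(t - s) * |u - t| ^ (-(2 : ℝ)⁻¹) := by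
  rw [pairWeight_eq, abs_rpow_neg_half, abs_of_pos (by linarith : 0 < u - s),
    abs_of_pos (by linarith : 0 < u - t)]
  have hX : 0 < √(u - s) := Real.sqrt_pos.2 (by linarith)
  have hY : 0 < √(u - t) := Real.sqrt_pos.2 (by linarith)
  have hXs := Real.mul_self_sqrt (by linarith : 0 ≤ u - s)
  have h := abs_sqrt_sub_sqrt_le (u - s) (u - t) (by linarith) (by linarith)
  rw [show |u - s - (u - t)| = t - s by
    rw [show u - s - (u - t) = t - s by ring, abs_of_pos (by linarith)]] at h
  have e : (u - s) * ((√(u - s))⁻¹ * (√(u - t))⁻¹) - 1 =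
      (√(u - s) - √(u - t)) * (√(u - t))⁻¹ := by
    nth_rewrite 1 [← hXs]
    field_simp
  rw [e, abs_mul, abs_of_pos (inv_pos.2 hY)]
  gcongr

theorem sub_mul_pairWeight_mid {s t u : ℝ} (hu : u ∈ Set.Ioo s t) :
    |(u - s) * pairWeight s t u - 0| ≤ √(t - s) * |u - t| ^ (-(2 : ℝ)⁻¹) := by
  obtain ⟨h1, h2⟩ := hu
  rw [pairWeight_eq, abs_rpow_neg_half, abs_of_pos (by linarith : 0 < u - s), sub_zero]
  have hX : 0 < √(u - s) := Real.sqrt_pos.2 (by linarith)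
  have hXs := Real.mul_self_sqrt (by linarith : 0 ≤ u - s)
  have e : (u - s) * ((√(u - s))⁻¹ * (√|u - t|)⁻¹) = √(u - s) * (√|u - t|)⁻¹ := by
    nth_rewrite 1 [← hXs]
    field_simp
  rw [e, abs_of_nonneg (by positivity)]
  gcongr

theorem pairWeight_le_mid {s t u : ℝ} (hu : u ∈ Set.Ioo s t) :
    pairWeight s t u ≤ (√(t - s))⁻¹ * ((√(u - s))⁻¹ + (√(t - u))⁻¹) := by
  obtain ⟨h1, h2⟩ := hu
  rw [pairWeight_eq, abs_of_pos (by linarith : 0 < u - s), abs_of_neg (by linarith : u - t < 0),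
    neg_sub]
  have hX : 0 < √(u - s) := Real.sqrt_pos.2 (by linarith)
  have hY : 0 < √(t - u) := Real.sqrt_pos.2 (by linarith)
  have hE : 0 < √(t - s) := Real.sqrt_pos.2 (by linarith)
  have h : √(t - s) ≤ √(u - s) + √(t - u) := by
    have := abs_sqrt_sub_sqrt_le (t - s) (u - s) (by linarith) (by linarith)
    rw [show t - s - (u - s) = t - u by ring, abs_of_pos (by linarith : 0 < t - u)] at this
    linarith [le_abs_self (√(t - s) - √(u - s))]
  rw [show (√(u - s))⁻¹ + (√(t - u))⁻¹ = (√(u - s) + √(t - u)) * ((√(u - s))⁻¹ * (√(t - u))⁻¹) by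
    field_simp; ring, ← mul_assoc]
  refine le_mul_of_one_le_left (by positivity) ?_
  rw [inv_mul_eq_div, one_le_div hE]
  exact h

theorem pairWeight_le_far {s t u d : ℝ} (hd : 0 < d) (hs : d ≤ |u - s|) (ht : d ≤ |u - t|) :
    pairWeight s t u ≤ d⁻¹ := by
  rw [pairWeight_eq]
  have h0 : 0 < √d := Real.sqrt_pos.2 hd
  calc (√|u - s|)⁻¹ * (√|u - t|)⁻¹ ≤ (√d)⁻¹ * (√d)⁻¹ := by gcongr
    _ = d⁻¹ := by rw [← mul_inv, Real.mul_self_sqrt hd.le]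

/-- Fundamental theorem of calculus on an open interval for a nonnegative derivative. -/
theorem integral_Ioo_eq_sub_of_nonneg {a b : ℝ} (hab : a ≤ b) {G g : ℝ → ℝ}
    (hG : ContinuousOn G (Set.Icc a b)) (hd : ∀ u ∈ Set.Ioo a b, HasDerivAt G (g u) u)
    (hg : ∀ u ∈ Set.Ioo a b, 0 ≤ g u) :
    IntegrableOn g (Set.Ioo a b) ∧ ∫ u in Set.Ioo a b, g u = G b - G a := by
  have h1 : IntegrableOn g (Set.Ioc a b) :=
    intervalIntegral.integrableOn_deriv_of_nonneg hG hd hg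
  refine ⟨h1.mono_set Set.Ioo_subset_Ioc_self, ?_⟩
  rw [← integral_Ioc_eq_integral_Ioo, ← intervalIntegral.integral_of_le hab]
  exact intervalIntegral.integral_eq_sub_of_hasDerivAt_of_le hab hG hd
    ((intervalIntegrable_iff_integrableOn_Ioc_of_le hab).2 h1)

theorem integral_pairWeight_left {A s t : ℝ} (hA : A ≤ s) (hst : s < t) :
    IntegrableOn (pairWeight s t) (Set.Ioo A s) ∧
    ∫ u in Set.Ioo A s, pairWeight s t u =
      -Real.log (t - s) + 2 * Real.log (√(s - A) + √(t - A)) := by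
  have h := integral_Ioo_eq_sub_of_nonneg hA
    (G := fun u => -2 * Real.log (√(s - u) + √(t - u))) (g := pairWeight s t) ?_ ?_ ?_
  · refine ⟨h.1, h.2.trans ?_⟩
    simp only [sub_self, Real.sqrt_zero, zero_add]
    rw [Real.log_sqrt (by linarith)]
    ring
  · refine ContinuousOn.const_mul ?_ _ |>.congr fun _ _ => rfl
    refine ContinuousOn.log (by fun_prop) fun u hu => ?_
    have : 0 < √(t - u) := Real.sqrt_pos.2 (by linarith [hu.2])
    positivity
  · intro u hu
    have h1 : 0 < s - u := by linarith [hu.2]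
    have h2 : 0 < t - u := by linarith [hu.2]
    have hX : 0 < √(s - u) := Real.sqrt_pos.2 h1
    have hY : 0 < √(t - u) := Real.sqrt_pos.2 h2
    have d1 : HasDerivAt (fun u => √(s - u)) (-1 / (2 * √(s - u))) u :=
      ((hasDerivAt_id u).const_sub s).sqrt h1.ne'
    have d2 : HasDerivAt (fun u => √(t - u)) (-1 / (2 * √(t - u))) u :=
      ((hasDerivAt_id u).const_sub t).sqrt h2.ne'
    have d3 := ((d1.add d2).log (by simp only [Pi.add_apply]; positivity)).const_mul (-2)
    refine d3.congr_deriv ?_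
    simp only [Pi.add_apply]
    rw [pairWeight_eq, abs_of_neg (by linarith : u - s < 0), abs_of_neg (by linarith : u - t < 0),
      neg_sub, neg_sub]
    field_simp
    ring
  · exact fun u _ => pairWeight_nonneg s t u

theorem integral_inv_sqrt_add_inv_sqrt {s t : ℝ} (hst : s < t) :
    IntegrableOn (fun u => (√(u - s))⁻¹ + (√(t - u))⁻¹) (Set.Ioo s t) ∧
    ∫ u in Set.Ioo s t, ((√(u - s))⁻¹ + (√(t - u))⁻¹) = 4 * √(t - s) := by
  have h := integral_Ioo_eq_sub_of_nonneg hst.le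
    (G := fun u => 2 * √(u - s) - 2 * √(t - u)) (g := fun u => (√(u - s))⁻¹ + (√(t - u))⁻¹)
    (by fun_prop) ?_ ?_
  · refine ⟨h.1, h.2.trans ?_⟩
    simp only [sub_self, Real.sqrt_zero]
    ring
  · intro u hu
    have h1 : 0 < u - s := by linarith [hu.1]
    have h2 : 0 < t - u := by linarith [hu.2]
    have hX : 0 < √(u - s) := Real.sqrt_pos.2 h1
    have hY : 0 < √(t - u) := Real.sqrt_pos.2 h2
    have d1 : HasDerivAt (fun u => √(u - s)) (1 / (2 * √(u - s))) u :=
      ((hasDerivAt_id u).sub_const s).sqrt h1.ne'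
    have d2 : HasDerivAt (fun u => √(t - u)) (-1 / (2 * √(t - u))) u :=
      ((hasDerivAt_id u).const_sub t).sqrt h2.ne'
    refine ((d1.const_mul 2).sub (d2.const_mul 2)).congr_deriv ?_
    field_simp
    ring
  · intro u _
    positivity

theorem exists_bound_near {f : ℝ → ℝ} {ξ : ℝ} (hfc : ContinuousAt f ξ) :
    ∃ d > 0, ∃ M > 0, ∀ u, |u - ξ| < d → |f u| ≤ M := by
  obtain ⟨d, hd, h⟩ := Metric.continuousAt_iff.1 hfc 1 one_pos
  refine ⟨d, hd, |f ξ| + 1, by positivity, fun u hu => ?_⟩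
  have := h (x := u) (by rwa [Real.dist_eq])
  rw [Real.dist_eq] at this
  have := abs_sub_abs_le_abs_sub (f u) (f ξ)
  linarith

theorem exists_integral_mul_rpow_le {f : ℝ → ℝ} {ξ : ℝ} (hf : LocallyIntegrable f)
    (hfc : ContinuousAt f ξ) (R : ℝ) :
    ∃ C, ∀ᶠ t in nhds ξ,
      IntegrableOn (fun u => |f u| * |u - t| ^ (-(2 : ℝ)⁻¹)) (Set.Icc (-R) R) ∧
      ∫ u in Set.Icc (-R) R, |f u| * |u - t| ^ (-(2 : ℝ)⁻¹) ≤ C := by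
  obtain ⟨d, hd, M, hM, hb⟩ := exists_bound_near hfc
  set g : ℝ → ℝ := Set.indicator (Set.Icc (-(2 * d)) (2 * d)) fun v => |v| ^ (-(2 : ℝ)⁻¹) with hg
  have hgi : Integrable g := by
    rw [hg, integrable_indicator_iff measurableSet_Icc]
    simpa using (locallyIntegrable_abs_sub_rpow 0).integrableOn_isCompact
      (isCompact_Icc (a := -(2 * d)) (b := 2 * d))
  have hg0 : ∀ v, 0 ≤ g v := fun v => Set.indicator_nonneg (fun _ _ => by positivity) v
  have hfi : IntegrableOn (fun u => |f u|) (Set.Icc (-R) R) :=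
    (hf.integrableOn_isCompact isCompact_Icc).norm
  refine ⟨M * (∫ v, g v) + (d / 2) ^ (-(2 : ℝ)⁻¹) * ∫ u in Set.Icc (-R) R, |f u|, ?_⟩
  have hnear : ∀ᶠ t in nhds ξ, |t - ξ| < d / 2 := by
    have := Metric.ball_mem_nhds ξ (half_pos hd)
    filter_upwards [this] with t ht
    rwa [Metric.mem_ball, Real.dist_eq] at ht
  filter_upwards [hnear] with t ht
  have hpt : ∀ u, |f u| * |u - t| ^ (-(2 : ℝ)⁻¹) ≤
      M * g (u - t) + (d / 2) ^ (-(2 : ℝ)⁻¹) * |f u| := by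
    intro u
    by_cases hu : |u - ξ| < d
    · have h1 : u - t ∈ Set.Icc (-(2 * d)) (2 * d) := by
        rw [abs_lt] at hu ht
        constructor <;> linarith [hu.1, hu.2, ht.1, ht.2]
      rw [hg, Set.indicator_of_mem h1]
      have h2 : 0 ≤ (d / 2) ^ (-(2 : ℝ)⁻¹) * |f u| := by positivity
      have h3 := mul_le_mul_of_nonneg_right (hb u hu)
        (by positivity : 0 ≤ |u - t| ^ (-(2 : ℝ)⁻¹))
      linarith
    · have h1 : d / 2 ≤ |u - t| := by
        have := abs_sub_abs_le_abs_sub (u - ξ) (t - ξ)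
        rw [show u - ξ - (t - ξ) = u - t by ring] at this
        linarith
      have h2 : |u - t| ^ (-(2 : ℝ)⁻¹) ≤ (d / 2) ^ (-(2 : ℝ)⁻¹) :=
        Real.rpow_le_rpow_of_nonpos (by positivity) h1 (by norm_num)
      have h3 := mul_le_mul_of_nonneg_right h2 (abs_nonneg (f u))
      have h4 := mul_nonneg hM.le (hg0 (u - t))
      linarith
  have hgt : Integrable (fun u => M * g (u - t)) := (hgi.comp_sub_right t).const_mul M
  have hbi : IntegrableOn (fun u => M * g (u - t) + (d / 2) ^ (-(2 : ℝ)⁻¹) * |f u|)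
      (Set.Icc (-R) R) := hgt.integrableOn.add (hfi.const_mul _)
  have hmi : IntegrableOn (fun u => |f u| * |u - t| ^ (-(2 : ℝ)⁻¹)) (Set.Icc (-R) R) := by
    refine Integrable.mono' hbi ?_ (Filter.Eventually.of_forall fun u => ?_)
    · exact hfi.aestronglyMeasurable.mul
        (by fun_prop : Measurable fun u : ℝ => |u - t| ^ (-(2 : ℝ)⁻¹)).aestronglyMeasurable
    · rw [Real.norm_of_nonneg (by positivity)]
      exact hpt u
  refine ⟨hmi, (setIntegral_mono hmi hbi hpt).trans ?_⟩
  rw [integral_add hgt.integrableOn (hfi.const_mul _), integral_const_mul, integral_const_mul]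
  gcongr
  refine (setIntegral_le_integral (hgi.comp_sub_right t)
    (Filter.Eventually.of_forall fun u => hg0 _)).trans_eq ?_
  exact integral_sub_right_eq_self g t

section Limits

variable {ι : Type*} {l : Filter ι} {s t : ι → ℝ} {ξ : ℝ}

theorem tendsto_integral_sub_mul_pairWeight {f : ℝ → ℝ} (hf : LocallyIntegrable f)
    (hfc : ContinuousAt f ξ) (hs : Filter.Tendsto s l (nhds ξ)) (ht : Filter.Tendsto t l (nhds ξ))
    {a b : ι → ℝ} {A B : ℝ} (ha : Filter.Tendsto a l (nhds A)) (hb : Filter.Tendsto b l (nhds B))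
    (σ : ℝ) (hab : ∀ᶠ p in l, a p ≤ b p)
    (hσ : ∀ᶠ p in l, ∀ u ∈ Set.Ioo (a p) (b p),
      |(u - s p) * pairWeight (s p) (t p) u - σ| ≤
        √(t p - s p) * |u - t p| ^ (-(2 : ℝ)⁻¹)) :
    Filter.Tendsto (fun p => ∫ u in Set.Ioo (a p) (b p),
      (u - s p) * f u * pairWeight (s p) (t p) u) l (nhds (σ * ∫ u in A..B, f u)) := by
  set R : ℝ := max |A| |B| + 1 with hR
  have haR : ∀ᶠ p in l, -R ≤ a p := by
    refine (ha.eventually (lt_mem_nhds (a := -R) ?_)).mono fun p hp => hp.le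
    have := neg_abs_le A
    have := le_max_left |A| |B|
    linarith
  have hbR : ∀ᶠ p in l, b p ≤ R := by
    refine (hb.eventually (gt_mem_nhds (a := R) ?_)).mono fun p hp => hp.le
    have := le_abs_self B
    have := le_max_right |A| |B|
    linarith
  obtain ⟨C, hC⟩ := exists_integral_mul_rpow_le hf hfc R
  have hloc : ∀ x y, IntervalIntegrable f volume x y := fun x y =>
    intervalIntegrable_iff.2
      ((hf.integrableOn_isCompact isCompact_uIcc).mono_set Set.uIoc_subset_uIcc)
  have hmain : Filter.Tendsto (fun p => σ * ∫ u in (a p)..(b p), f u) l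
      (nhds (σ * ∫ u in A..B, f u)) := by
    refine Filter.Tendsto.const_mul σ ?_
    have hcont := intervalIntegral.continuous_primitive hloc 0
    have e : ∀ x y, ∫ u in x..y, f u = (∫ u in (0 : ℝ)..y, f u) - ∫ u in (0 : ℝ)..x, f u :=
      fun x y => (intervalIntegral.integral_interval_sub_left (hloc _ _) (hloc _ _)).symm
    rw [e A B]
    exact (((hcont.tendsto B).comp hb).sub ((hcont.tendsto A).comp ha)).congr
      fun p => (e _ _).symm
  have herr : Filter.Tendsto (fun p => √(t p - s p) * C) l (nhds 0) := by
    have : Filter.Tendsto (fun p => √(t p - s p)) l (nhds 0) := by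
      have := (ht.sub hs).sqrt
      simpa using this
    simpa using this.mul_const C
  refine tendsto_of_tendsto_of_dist hmain ?_
  refine squeeze_zero' (Filter.Eventually.of_forall fun _ => dist_nonneg) ?_ herr
  filter_upwards [haR, hbR, ht.eventually hC, hab, hσ] with p h1 h2 h3 h4 h5
  have hsub : Set.Ioo (a p) (b p) ⊆ Set.Icc (-R) R :=
    fun u hu => ⟨h1.trans hu.1.le, hu.2.le.trans h2⟩
  have hfi : IntegrableOn f (Set.Ioo (a p) (b p)) :=
    (hf.integrableOn_isCompact isCompact_Icc).mono_set hsub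
  have hKi := h3.1.mono_set hsub
  have hdi : IntegrableOn (fun u => √(t p - s p) * (|f u| * |u - t p| ^ (-(2 : ℝ)⁻¹)))
      (Set.Ioo (a p) (b p)) := hKi.const_mul _
  have hbd : ∀ u ∈ Set.Ioo (a p) (b p),
      ‖(u - s p) * f u * pairWeight (s p) (t p) u - σ * f u‖ ≤
        √(t p - s p) * (|f u| * |u - t p| ^ (-(2 : ℝ)⁻¹)) := by
    intro u hu
    rw [show (u - s p) * f u * pairWeight (s p) (t p) u - σ * f u =
      ((u - s p) * pairWeight (s p) (t p) u - σ) * f u by ring, norm_mul, Real.norm_eq_abs,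
      Real.norm_eq_abs]
    have := mul_le_mul_of_nonneg_right (h5 u hu) (abs_nonneg (f u))
    linarith
  have hae : ∀ᵐ u ∂(volume.restrict (Set.Ioo (a p) (b p))),
      ‖(u - s p) * f u * pairWeight (s p) (t p) u - σ * f u‖ ≤
        √(t p - s p) * (|f u| * |u - t p| ^ (-(2 : ℝ)⁻¹)) :=
    (ae_restrict_iff' measurableSet_Ioo).2 (Filter.Eventually.of_forall hbd)
  have hmeas : AEStronglyMeasurable (fun u => (u - s p) * f u * pairWeight (s p) (t p) u)
      (volume.restrict (Set.Ioo (a p) (b p))) :=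
    ((by fun_prop : Measurable fun u : ℝ => u - s p).aestronglyMeasurable.mul
      hfi.aestronglyMeasurable).mul (measurable_pairWeight _ _).aestronglyMeasurable
  have hσi : IntegrableOn (fun u => σ * f u) (Set.Ioo (a p) (b p)) := hfi.const_mul σ
  have hsubi : IntegrableOn (fun u => (u - s p) * f u * pairWeight (s p) (t p) u - σ * f u)
      (Set.Ioo (a p) (b p)) := Integrable.mono' hdi (hmeas.sub hσi.aestronglyMeasurable) hae
  have hFi : IntegrableOn (fun u => (u - s p) * f u * pairWeight (s p) (t p) u)
      (Set.Ioo (a p) (b p)) := by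
    refine (hsubi.add hσi).congr (Filter.Eventually.of_forall fun u => ?_)
    simp
  rw [intervalIntegral.integral_of_le h4, integral_Ioc_eq_integral_Ioo, dist_comm,
    Real.dist_eq, ← integral_const_mul, ← integral_sub hFi hσi, ← Real.norm_eq_abs]
  refine (norm_integral_le_of_norm_le hdi hae).trans ?_
  rw [integral_const_mul]
  refine mul_le_mul_of_nonneg_left ?_ (Real.sqrt_nonneg _)
  refine (setIntegral_mono_set h3.1 ?_ hsub.eventuallyLE).trans h3.2
  exact Filter.Eventually.of_forall fun u => by positivity

theorem tendsto_abs_log_sub_atTop (hs : Filter.Tendsto s l (nhds ξ))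
    (ht : Filter.Tendsto t l (nhds ξ)) (hst : ∀ᶠ p in l, s p < t p) :
    Filter.Tendsto (fun p => |Real.log (t p - s p)|) l Filter.atTop := by
  have h0 : Filter.Tendsto (fun p => t p - s p) l (nhdsWithin 0 (Set.Ioi 0)) := by
    refine tendsto_nhdsWithin_iff.2 ⟨by simpa using ht.sub hs, ?_⟩
    filter_upwards [hst] with p hp
    exact sub_pos.2 hp
  exact Filter.tendsto_abs_atBot_atTop.comp (Real.tendsto_log_nhdsGT_zero.comp h0)

theorem tendsto_div_abs_log_of_bounded (hs : Filter.Tendsto s l (nhds ξ))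
    (ht : Filter.Tendsto t l (nhds ξ)) (hst : ∀ᶠ p in l, s p < t p) {F : ι → ℝ} {C : ℝ}
    (hF : ∀ᶠ p in l, |F p| ≤ C) :
    Filter.Tendsto (fun p => F p / |Real.log (t p - s p)|) l (nhds 0) := by
  have hL := tendsto_abs_log_sub_atTop hs ht hst
  have h1 : Filter.Tendsto (fun p => C / |Real.log (t p - s p)|) l (nhds 0) :=
    hL.const_div_atTop C
  refine squeeze_zero_norm' ?_ h1
  filter_upwards [hF] with p hp
  rw [norm_div, Real.norm_eq_abs, Real.norm_eq_abs, abs_abs]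
  gcongr

theorem tendsto_integral_mul_pairWeight_far {f : ℝ → ℝ} (hf : LocallyIntegrable f)
    (hs : Filter.Tendsto s l (nhds ξ)) (ht : Filter.Tendsto t l (nhds ξ))
    (hst : ∀ᶠ p in l, s p < t p) {a b : ℝ} (hξ : ξ ∉ Set.Icc a b) :
    Filter.Tendsto (fun p => (∫ u in Set.Ioo a b, f u * pairWeight (s p) (t p) u) /
      |Real.log (t p - s p)|) l (nhds 0) := by
  obtain ⟨d, hd, hball⟩ := Metric.isOpen_iff.1 isClosed_Icc.isOpen_compl ξ hξ
  refine tendsto_div_abs_log_of_bounded (C := ∫ u in Set.Ioo a b, |f u| * (d / 2)⁻¹) hs ht hst ?_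
  have hnear : ∀ᶠ x in nhds ξ, |x - ξ| < d / 2 := by
    filter_upwards [Metric.ball_mem_nhds ξ (half_pos hd)] with t ht
    rwa [Metric.mem_ball, Real.dist_eq] at ht
  filter_upwards [hs.eventually hnear, ht.eventually hnear] with p h1 h2
  have hfi : IntegrableOn f (Set.Ioo a b) :=
    (hf.integrableOn_isCompact isCompact_Icc).mono_set Set.Ioo_subset_Icc_self
  rw [← Real.norm_eq_abs]
  refine norm_integral_le_of_norm_le (hfi.norm.mul_const _) ?_
  refine (ae_restrict_iff' measurableSet_Ioo).2 (Filter.Eventually.of_forall fun u hu => ?_)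
  rw [norm_mul, Real.norm_of_nonneg (pairWeight_nonneg _ _ _)]
  have hu' : d ≤ |u - ξ| := by
    by_contra h
    exact hball (by rw [Metric.mem_ball, Real.dist_eq]; linarith) (Set.Ioo_subset_Icc_self hu)
  have key : ∀ x, |x - ξ| < d / 2 → d / 2 ≤ |u - x| := by
    intro x hx
    have := abs_sub_abs_le_abs_sub (u - ξ) (x - ξ)
    rw [show u - ξ - (x - ξ) = u - x by ring] at this
    linarith
  refine mul_le_mul_of_nonneg_left ?_ (norm_nonneg _)
  exact pairWeight_le_far (half_pos hd) (key _ h1) (key _ h2)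

theorem tendsto_integral_mul_pairWeight_mid {f : ℝ → ℝ} (hfc : ContinuousAt f ξ)
    (hs : Filter.Tendsto s l (nhds ξ)) (ht : Filter.Tendsto t l (nhds ξ))
    (hst : ∀ᶠ p in l, s p < t p) :
    Filter.Tendsto (fun p => (∫ u in Set.Ioo (s p) (t p), f u * pairWeight (s p) (t p) u) /
      |Real.log (t p - s p)|) l (nhds 0) := by
  obtain ⟨d, hd, M, hM, hb⟩ := exists_bound_near hfc
  refine tendsto_div_abs_log_of_bounded (C := M * 4) hs ht hst ?_
  have hnear : ∀ᶠ x in nhds ξ, |x - ξ| < d := by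
    filter_upwards [Metric.ball_mem_nhds ξ hd] with t ht
    rwa [Metric.mem_ball, Real.dist_eq] at ht
  filter_upwards [hs.eventually hnear, ht.eventually hnear, hst] with p h1 h2 h3
  obtain ⟨hi, hv⟩ := integral_inv_sqrt_add_inv_sqrt h3
  have hE : 0 < √(t p - s p) := Real.sqrt_pos.2 (by linarith)
  rw [← Real.norm_eq_abs]
  refine (norm_integral_le_of_norm_le ((hi.const_mul (√(t p - s p))⁻¹).const_mul M) ?_).trans_eq ?_
  · refine (ae_restrict_iff' measurableSet_Ioo).2 (Filter.Eventually.of_forall fun u hu => ?_)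
    rw [norm_mul, Real.norm_of_nonneg (pairWeight_nonneg _ _ _), Real.norm_eq_abs]
    refine mul_le_mul (hb u ?_) (pairWeight_le_mid hu) (pairWeight_nonneg _ _ _) hM.le
    rw [abs_lt] at h1 h2 ⊢
    constructor <;> linarith [hu.1, hu.2]
  · rw [integral_const_mul, integral_const_mul, hv]
    field_simp

theorem tendsto_integral_mul_pairWeight_left {f : ℝ → ℝ} (hf : LocallyIntegrable f)
    (hfc : ContinuousAt f ξ) (hs : Filter.Tendsto s l (nhds ξ)) (ht : Filter.Tendsto t l (nhds ξ))
    (hst : ∀ᶠ p in l, s p < t p) {A : ℝ} (hA : A < ξ) :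
    Filter.Tendsto (fun p => (∫ u in Set.Ioo A (s p), f u * pairWeight (s p) (t p) u) /
      |Real.log (t p - s p)|) l (nhds (f ξ)) := by
  have hL := tendsto_abs_log_sub_atTop hs ht hst
  have hAs : ∀ᶠ p in l, A < s p := hs.eventually (lt_mem_nhds hA)
  have hsmall : ∀ᶠ p in l, t p - s p < 1 := by
    have : Filter.Tendsto (fun p => t p - s p) l (nhds 0) := by simpa using ht.sub hs
    exact this.eventually (gt_mem_nhds one_pos)
  have hlogC : Filter.Tendsto (fun p => 2 * Real.log (√(s p - A) + √(t p - A))) l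
      (nhds (2 * Real.log (√(ξ - A) + √(ξ - A)))) := by
    refine Filter.Tendsto.const_mul 2 (Filter.Tendsto.log ?_ ?_)
    · exact ((hs.sub_const A).sqrt).add ((ht.sub_const A).sqrt)
    · have : 0 < √(ξ - A) := Real.sqrt_pos.2 (by linarith)
      positivity
  have hJ : Filter.Tendsto (fun p => (∫ u in Set.Ioo A (s p), pairWeight (s p) (t p) u) /
      |Real.log (t p - s p)|) l (nhds 1) := by
    have h1 : Filter.Tendsto (fun p => 1 + 2 * Real.log (√(s p - A) + √(t p - A)) /
        |Real.log (t p - s p)|) l (nhds (1 + 0)) := (hlogC.div_atTop hL).const_add 1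
    rw [add_zero] at h1
    refine h1.congr' ?_
    filter_upwards [hAs, hst, hsmall, hL.eventually_gt_atTop 0] with p h1 h2 h3 h4
    rw [(integral_pairWeight_left h1.le h2).2]
    have : |Real.log (t p - s p)| = -Real.log (t p - s p) :=
      abs_of_nonpos (Real.log_nonpos (by linarith) h3.le)
    rw [← this]
    field_simp
  set g : ℝ → ℝ := fun u => f u - f ξ with hg
  have hgl : LocallyIntegrable g := hf.sub (locallyIntegrable_const _)
  have hgc : ContinuousAt g ξ := hfc.sub continuousAt_const
  have hbound : ∀ η > 0, ∃ C, ∀ᶠ p in l,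
      IntegrableOn (fun u => g u * pairWeight (s p) (t p) u) (Set.Ioo A (s p)) ∧
      |∫ u in Set.Ioo A (s p), g u * pairWeight (s p) (t p) u| ≤
        η * (∫ u in Set.Ioo A (s p), pairWeight (s p) (t p) u) + C := by
    intro η hη
    obtain ⟨d, hd, hdη⟩ := Metric.continuousAt_iff.1 hgc η hη
    refine ⟨(d / 2)⁻¹ * ∫ u in Set.Icc A (ξ + 1), |g u|, ?_⟩
    have hnear : ∀ᶠ x in nhds ξ, |x - ξ| < min (d / 2) 1 := by
      filter_upwards [Metric.ball_mem_nhds ξ (lt_min (half_pos hd) one_pos)] with t ht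
      rwa [Metric.mem_ball, Real.dist_eq] at ht
    filter_upwards [hAs, hst, hs.eventually hnear, ht.eventually hnear] with p h1 h2 h3 h4
    rw [lt_min_iff] at h3 h4
    have hsub : Set.Ioo A (s p) ⊆ Set.Icc A (ξ + 1) := fun u hu =>
      ⟨hu.1.le, by linarith [hu.2, (abs_lt.1 h3.2).2]⟩
    have hgi : IntegrableOn (fun u => |g u|) (Set.Icc A (ξ + 1)) :=
      (hgl.integrableOn_isCompact isCompact_Icc).norm
    have hKi := (integral_pairWeight_left h1.le h2).1
    have hpt : ∀ u, ‖g u * pairWeight (s p) (t p) u‖ ≤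
        η * pairWeight (s p) (t p) u + (d / 2)⁻¹ * |g u| := by
      intro u
      have hK0 := pairWeight_nonneg (s p) (t p) u
      rw [norm_mul, Real.norm_of_nonneg hK0, Real.norm_eq_abs]
      by_cases hu : |u - ξ| < d
      · have h5 := hdη (x := u) (by rwa [Real.dist_eq])
        rw [Real.dist_eq, show g ξ = 0 by simp [hg], sub_zero] at h5
        have := mul_le_mul_of_nonneg_right h5.le hK0
        have : 0 ≤ (d / 2)⁻¹ * |g u| := by positivity
        linarith
      · have key : ∀ x, |x - ξ| < d / 2 → d / 2 ≤ |u - x| := by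
          intro x hx
          have := abs_sub_abs_le_abs_sub (u - ξ) (x - ξ)
          rw [show u - ξ - (x - ξ) = u - x by ring] at this
          linarith
        have h5 := mul_le_mul_of_nonneg_left
          (pairWeight_le_far (half_pos hd) (key _ h3.1) (key _ h4.1)) (abs_nonneg (g u))
        have : 0 ≤ η * pairWeight (s p) (t p) u := by positivity
        linarith
    have hgi' := hgi.mono_set hsub
    have hbi : IntegrableOn (fun u => η * pairWeight (s p) (t p) u + (d / 2)⁻¹ * |g u|)
        (Set.Ioo A (s p)) := (hKi.const_mul η).add (hgi'.const_mul _)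
    refine ⟨Integrable.mono' hbi ?_ (Filter.Eventually.of_forall hpt), ?_⟩
    · exact hgl.aestronglyMeasurable.restrict.mul
        (measurable_pairWeight _ _).aestronglyMeasurable
    · rw [← Real.norm_eq_abs]
      refine (norm_integral_le_of_norm_le hbi (Filter.Eventually.of_forall hpt)).trans ?_
      rw [integral_add (hKi.const_mul η) (hgi'.const_mul _), integral_const_mul,
        integral_const_mul]
      gcongr
      exact Filter.Eventually.of_forall fun u => abs_nonneg (g u)
  have hG : Filter.Tendsto (fun p => (∫ u in Set.Ioo A (s p), g u * pairWeight (s p) (t p) u) /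
      |Real.log (t p - s p)|) l (nhds 0) := by
    rw [Metric.tendsto_nhds]
    intro η hη
    obtain ⟨C, hC⟩ := hbound (η / 3) (by positivity)
    have h1 : Filter.Tendsto (fun p => η / 3 *
        ((∫ u in Set.Ioo A (s p), pairWeight (s p) (t p) u) / |Real.log (t p - s p)|) +
        C / |Real.log (t p - s p)|) l (nhds (η / 3 * 1 + 0)) :=
      (hJ.const_mul _).add (hL.const_div_atTop C)
    filter_upwards [hC, h1.eventually (gt_mem_nhds (by linarith : η / 3 * 1 + 0 < η)),
      hL.eventually_gt_atTop 0] with p h2 h3 h4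
    rw [Real.dist_eq, sub_zero, abs_div, abs_abs]
    refine lt_of_le_of_lt ?_ h3
    rw [← mul_div_assoc, ← add_div]
    gcongr
    exact h2.2
  obtain ⟨C, hC⟩ := hbound 1 one_pos
  have := (hJ.const_mul (f ξ)).add hG
  rw [mul_one, add_zero] at this
  refine this.congr' ?_
  filter_upwards [hC, hAs, hst] with p h1 h2 h3
  have hKi := (integral_pairWeight_left h2.le h3).1
  rw [← mul_div_assoc, ← add_div, ← integral_const_mul,
    ← integral_add (hKi.const_mul (f ξ)) h1.1]
  congr 1
  refine integral_congr_ae (Filter.Eventually.of_forall fun u => ?_)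
  simp only [hg]
  ring

theorem tendsto_integral_mul_pairWeight_right {f : ℝ → ℝ} (hf : LocallyIntegrable f)
    (hfc : ContinuousAt f ξ) (hs : Filter.Tendsto s l (nhds ξ)) (ht : Filter.Tendsto t l (nhds ξ))
    (hst : ∀ᶠ p in l, s p < t p) {B : ℝ} (hB : ξ < B) :
    Filter.Tendsto (fun p => (∫ u in Set.Ioo (t p) B, f u * pairWeight (s p) (t p) u) /
      |Real.log (t p - s p)|) l (nhds (f ξ)) := by
  have hf' : LocallyIntegrable fun u => f (-u) := by
    have := (locallyIntegrable_map_homeomorph (Homeomorph.neg ℝ) (f := f) (μ := volume)).1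
    rw [show Measure.map (Homeomorph.neg ℝ) (volume : Measure ℝ) = volume from
      (Measure.measurePreserving_neg (volume : Measure ℝ)).map_eq] at this
    exact this hf
  have hfc' : ContinuousAt (fun u => f (-u)) (-ξ) :=
    ContinuousAt.comp (f := fun u : ℝ => -u) (by simpa using hfc) continuous_neg.continuousAt
  have h := tendsto_integral_mul_pairWeight_left hf' hfc' ht.neg hs.neg
    (hst.mono fun p hp => neg_lt_neg hp) (A := -B) (neg_lt_neg hB)
  rw [neg_neg] at h
  refine h.congr fun p => ?_
  rw [show -s p - -t p = t p - s p by ring]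
  congr 1
  have h1 := (Measure.measurePreserving_neg (volume : Measure ℝ)).setIntegral_preimage_emb
    (Homeomorph.neg ℝ).measurableEmbedding (fun u => f u * pairWeight (s p) (t p) u)
    (Set.Ioo (t p) B)
  rw [← h1]
  rw [show (fun x : ℝ => -x) ⁻¹' Set.Ioo (t p) B = Set.Ioo (-B) (-t p) by
    ext u; simp only [Set.mem_preimage, Set.mem_Ioo]; constructor <;> rintro ⟨h1, h2⟩ <;>
      constructor <;> linarith]
  refine integral_congr_ae (Filter.Eventually.of_forall fun u => ?_)
  simp only [pairWeight]
  rw [show u - -s p = -(-u - s p) by ring, show u - -t p = -(-u - t p) by ring, abs_neg, abs_neg,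
    mul_comm (|-u - s p| ^ _)]

end Limits

/-- The increasing enumeration of the naturals other than `j` and `j + 1`. -/
def skipIdx (j i : ℕ) : ℕ := if i < j then i else i + 2

/-- The sequence `x` with its entries at `j` and `j + 1` replaced by `s` and `t`. -/
def insertPair (j : ℕ) (x : ℕ → ℝ) (s t : ℝ) : ℕ → ℝ :=
  Function.update (Function.update x j s) (j + 1) t

theorem insertPair_apply (j : ℕ) (x : ℕ → ℝ) (s t : ℝ) (k : ℕ) :
    insertPair j x s t k = if k = j + 1 then t else if k = j then s else x k := by
  simp only [insertPair, Function.update_apply]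

theorem insertPair_self (j : ℕ) (x : ℕ → ℝ) (s t : ℝ) : insertPair j x s t j = s := by
  simp [insertPair_apply]

theorem insertPair_succ (j : ℕ) (x : ℕ → ℝ) (s t : ℝ) : insertPair j x s t (j + 1) = t := by
  simp [insertPair_apply]

theorem insertPair_of_ne {j k : ℕ} (x : ℕ → ℝ) (s t : ℝ) (h : k ≠ j) (h' : k ≠ j + 1) :
    insertPair j x s t k = x k := by
  simp [insertPair_apply, h, h']

theorem skipIdx_ne (j i : ℕ) : skipIdx j i ≠ j ∧ skipIdx j i ≠ j + 1 := by
  unfold skipIdx; split_ifs <;> omega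

theorem skipIdx_strictMono (j : ℕ) : StrictMono (skipIdx j) := by
  intro a b hab
  unfold skipIdx; split_ifs <;> omega

theorem insertPair_skipIdx (j : ℕ) (x : ℕ → ℝ) (s t : ℝ) (i : ℕ) :
    insertPair j x s t (skipIdx j i) = x (skipIdx j i) :=
  insertPair_of_ne x s t (skipIdx_ne j i).1 (skipIdx_ne j i).2

theorem prod_Icc_skipIdx {M : Type*} [CommMonoid M] {n j : ℕ} (hj1 : 1 ≤ j) (hj2 : j ≤ 2 * n + 1)
    (h : ℕ → M) :
    ∏ i ∈ Finset.Icc 1 (2 * (n + 1)), h i =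
      h j * (h (j + 1) * ∏ i ∈ Finset.Icc 1 (2 * n), h (skipIdx j i)) := by
  have e : Finset.Icc 1 (2 * (n + 1)) =
      insert j (insert (j + 1) ((Finset.Icc 1 (2 * n)).image (skipIdx j))) := by
    ext k
    simp only [Finset.mem_Icc, Finset.mem_insert, Finset.mem_image, skipIdx]
    constructor
    · intro hk
      by_cases h1 : k < j
      · exact Or.inr (Or.inr ⟨k, by omega, by simp [h1]⟩)
      · by_cases h2 : k = j
        · exact Or.inl h2
        · by_cases h3 : k = j + 1
          · exact Or.inr (Or.inl h3)
          · exact Or.inr (Or.inr ⟨k - 2, by omega, by rw [if_neg (by omega)]; omega⟩)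
    · rintro (rfl | rfl | ⟨i, hi, rfl⟩)
      · omega
      · omega
      · split_ifs <;> omega
  rw [e, Finset.prod_insert, Finset.prod_insert,
    Finset.prod_image (skipIdx_strictMono j).injective.injOn]
  · simp only [Finset.mem_image, not_exists, not_and]
    exact fun i _ => (skipIdx_ne j i).2
  · simp only [Finset.mem_insert, Finset.mem_image, not_or, not_exists, not_and]
    exact ⟨by omega, fun i _ => (skipIdx_ne j i).1⟩

theorem coulombPrefactor_eq (N : ℕ) (x : ℕ → ℝ) :
    coulombPrefactor N x = ∏ i ∈ Finset.Icc 1 (2 * N), ∏ k ∈ Finset.Icc 1 (2 * N),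
      if i < k then (x k - x i) ^ ((4 : ℝ)⁻¹) else 1 := by
  rw [coulombPrefactor, Finset.prod_filter, Finset.prod_product]

theorem coulombPrefactor_insertPair {n j : ℕ} (hj1 : 1 ≤ j) (hj2 : j ≤ 2 * n + 1)
    {x : ℕ → ℝ} {s t : ℝ} (hx : IsChamber (n + 1) (insertPair j x s t)) :
    coulombPrefactor (n + 1) (insertPair j x s t) = (t - s) ^ ((4 : ℝ)⁻¹) *
      ((∏ i ∈ Finset.Icc 1 (2 * n), |s - x (skipIdx j i)| ^ ((4 : ℝ)⁻¹) *
        |t - x (skipIdx j i)| ^ ((4 : ℝ)⁻¹)) * coulombPrefactor n (x ∘ skipIdx j)) := by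
  rw [coulombPrefactor_eq, prod_Icc_skipIdx hj1 hj2]
  simp only [prod_Icc_skipIdx hj1 hj2 (M := ℝ), insertPair_self, insertPair_succ,
    insertPair_skipIdx, lt_irrefl, if_false, one_mul, lt_add_one, if_true]
  rw [if_neg (by omega), one_mul, mul_assoc, Finset.prod_mul_distrib, Finset.prod_mul_distrib,
    coulombPrefactor_eq]
  have hlt : ∀ i k, skipIdx j i < skipIdx j k ↔ i < k := fun i k =>
    (skipIdx_strictMono j).lt_iff_lt
  simp only [hlt, Function.comp_apply]
  congr 1
  simp only [← mul_assoc]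
  congr 1
  rw [← Finset.prod_mul_distrib, ← Finset.prod_mul_distrib, ← Finset.prod_mul_distrib]
  refine Finset.prod_congr rfl fun i hi => ?_
  rw [Finset.mem_Icc] at hi
  have hb : 1 ≤ skipIdx j i ∧ skipIdx j i ≤ 2 * (n + 1) := by
    unfold skipIdx; split_ifs <;> omega
  rcases lt_or_ge i j with h | h
  · have e : skipIdx j i = i := by simp [skipIdx, h]
    have h1 := hx i j hi.1 h (by omega)
    have h2 := hx i (j + 1) hi.1 (by omega) (by omega)
    rw [insertPair_of_ne x s t (by omega) (by omega)] at h1 h2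
    rw [insertPair_self] at h1
    rw [insertPair_succ] at h2
    rw [e, if_neg (by omega), if_neg (by omega), if_pos h, if_pos (by omega),
      abs_of_pos (by linarith), abs_of_pos (by linarith)]
    ring
  · have e : skipIdx j i = i + 2 := by simp [skipIdx, not_lt.2 h]
    have h1 := hx j (i + 2) hj1 (by omega) (by omega)
    have h2 := hx (j + 1) (i + 2) (by omega) (by omega) (by omega)
    rw [insertPair_of_ne (k := i + 2) x s t (by omega) (by omega)] at h1 h2
    rw [insertPair_self] at h1
    rw [insertPair_succ] at h2
    rw [e, if_pos (by omega), if_pos (by omega), if_neg (by omega), if_neg (by omega),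
      abs_of_neg (by linarith), abs_of_neg (by linarith), neg_sub, neg_sub]
    ring

/-- The locally integrable weight `∏ |u - y i|^(-1/2)`. -/
noncomputable def rootWeight (n : ℕ) (y : ℕ → ℝ) (u : ℝ) : ℝ :=
  ∏ i ∈ Finset.Icc 1 (2 * n), |u - y i| ^ (-(2 : ℝ)⁻¹)

theorem rootWeight_insertPair {n j : ℕ} (hj1 : 1 ≤ j) (hj2 : j ≤ 2 * n + 1) (x : ℕ → ℝ)
    (s t u : ℝ) :
    rootWeight (n + 1) (insertPair j x s t) u =
      pairWeight s t u * rootWeight n (x ∘ skipIdx j) u := by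
  rw [rootWeight, prod_Icc_skipIdx hj1 hj2, insertPair_self, insertPair_succ, pairWeight,
    rootWeight, mul_assoc]
  simp only [insertPair_skipIdx, Function.comp_apply]

theorem locallyIntegrable_pow_mul_rootWeight {n : ℕ} {y : ℕ → ℝ} (hy : IsChamber n y) (c : ℕ) :
    LocallyIntegrable fun u => u ^ c * rootWeight n y u := by
  rw [locallyIntegrable_iff]
  intro K hK
  exact ((locallyIntegrable_prod_abs_sub_rpow _ y hy.injOn).integrableOn_isCompact
    hK).continuousOn_mul (by fun_prop) hK

theorem continuousAt_pow_mul_rootWeight {n : ℕ} {y : ℕ → ℝ} {ξ : ℝ}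
    (h : ∀ i ∈ Finset.Icc 1 (2 * n), y i ≠ ξ) (c : ℕ) :
    ContinuousAt (fun u => u ^ c * rootWeight n y u) ξ :=
  (continuous_pow c).continuousAt.mul (continuousAt_prod_abs_sub_rpow _ y ξ h)

section Limit

variable {n j : ℕ} {x : ℕ → ℝ} {ξ : ℝ} {ι : Type*} {l : Filter ι} {s t : ι → ℝ}

theorem tendsto_insertPair (hs : Filter.Tendsto s l (nhds ξ)) (ht : Filter.Tendsto t l (nhds ξ))
    (k : ℕ) :
    Filter.Tendsto (fun p => insertPair j x (s p) (t p) k) l (nhds (insertPair j x ξ ξ k)) := by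
  simp only [insertPair_apply]
  split_ifs
  exacts [ht, hs, tendsto_const_nhds]

theorem IsChamber.le_of_le {N : ℕ} {y : ℕ → ℝ} (hy : IsChamber N y) {i k : ℕ} (hi : 1 ≤ i)
    (hik : i ≤ k) (hk : k ≤ 2 * N) : y i ≤ y k := by
  rcases hik.lt_or_eq with h | rfl
  exacts [(hy i k hi h hk).le, le_rfl]

theorem tendsto_moment_succ (hj1 : 1 ≤ j) (hj2 : j ≤ 2 * n + 1)
    (hs : Filter.Tendsto s l (nhds ξ)) (ht : Filter.Tendsto t l (nhds ξ))
    (hch : ∀ᶠ p in l, IsChamber (n + 1) (insertPair j x (s p) (t p)))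
    (hy : IsChamber n (x ∘ skipIdx j)) (hξ : ∀ i ∈ Finset.Icc 1 (2 * n), (x ∘ skipIdx j) i ≠ ξ)
    (c : ℕ) {k : ℕ} (hk : k ∈ Finset.Icc 1 (2 * (n + 1) - 1)) :
    Filter.Tendsto (fun p => ∫ u in Set.Ioo (insertPair j x (s p) (t p) k)
        (insertPair j x (s p) (t p) (k + 1)),
        ((Polynomial.X - Polynomial.C (s p)) * Polynomial.X ^ c).eval u *
          rootWeight (n + 1) (insertPair j x (s p) (t p)) u) l
      (nhds ((if k < j then -1 else if k = j then 0 else 1) *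
        ∫ u in (insertPair j x ξ ξ k)..(insertPair j x ξ ξ (k + 1)),
          u ^ c * rootWeight n (x ∘ skipIdx j) u)) := by
  rw [Finset.mem_Icc] at hk
  have h := tendsto_integral_sub_mul_pairWeight (locallyIntegrable_pow_mul_rootWeight hy c)
    (continuousAt_pow_mul_rootWeight hξ c) hs ht (tendsto_insertPair (x := x) (j := j) hs ht k)
    (tendsto_insertPair (x := x) (j := j) hs ht (k + 1))
    (if k < j then -1 else if k = j then 0 else 1) ?_ ?_
  · refine h.congr fun p => ?_
    congr 1
    funext u
    rw [rootWeight_insertPair hj1 hj2]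
    simp only [Polynomial.eval_mul, Polynomial.eval_sub, Polynomial.eval_X, Polynomial.eval_C,
      Polynomial.eval_pow]
    ring
  · filter_upwards [hch] with p hp
    exact hp.le_of_le hk.1 (by omega) (by omega)
  · filter_upwards [hch] with p hp u hu
    have hst := hp j (j + 1) hj1 (by omega) (by omega)
    rw [insertPair_self, insertPair_succ] at hst
    split_ifs with h1 h2
    · have := hp.le_of_le (i := k + 1) (k := j) (by omega) h1 (by omega)
      rw [insertPair_self] at this
      exact sub_mul_pairWeight_left hst (hu.2.trans_le this)
    · subst h2
      rw [insertPair_self, insertPair_succ] at hu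
      exact sub_mul_pairWeight_mid hu
    · have := hp.le_of_le (i := j + 1) (k := k) (by omega) (by omega) (by omega)
      rw [insertPair_succ] at this
      exact sub_mul_pairWeight_right hst (this.trans_lt hu.1)

theorem tendsto_moment_zero (hj1 : 1 ≤ j) (hj2 : j ≤ 2 * n + 1)
    (hs : Filter.Tendsto s l (nhds ξ)) (ht : Filter.Tendsto t l (nhds ξ))
    (hch : ∀ᶠ p in l, IsChamber (n + 1) (insertPair j x (s p) (t p)))
    (hy : IsChamber n (x ∘ skipIdx j))
    (hξlo : ∀ i : ℕ, 1 ≤ i → i < j → x i < ξ)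
    (hξhi : ∀ k : ℕ, j + 1 < k → k ≤ 2 * (n + 1) → ξ < x k)
    (hξ : ∀ i ∈ Finset.Icc 1 (2 * n), (x ∘ skipIdx j) i ≠ ξ)
    {k : ℕ} (hk : k ∈ Finset.Icc 1 (2 * (n + 1) - 1)) :
    Filter.Tendsto (fun p => (∫ u in Set.Ioo (insertPair j x (s p) (t p) k)
        (insertPair j x (s p) (t p) (k + 1)),
        (1 : Polynomial ℝ).eval u * rootWeight (n + 1) (insertPair j x (s p) (t p)) u) /
          |Real.log (t p - s p)|) l
      (nhds (if k + 1 = j ∨ k = j + 1 then rootWeight n (x ∘ skipIdx j) ξ else 0)) := by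
  rw [Finset.mem_Icc] at hk
  have hf := locallyIntegrable_pow_mul_rootWeight hy 0
  have hfc := continuousAt_pow_mul_rootWeight hξ 0
  simp only [pow_zero, one_mul] at hf hfc
  have hst : ∀ᶠ p in l, s p < t p := by
    filter_upwards [hch] with p hp
    have hst := hp j (j + 1) hj1 (by omega) (by omega)
    rwa [insertPair_self, insertPair_succ] at hst
  have e : ∀ p u, (1 : Polynomial ℝ).eval u * rootWeight (n + 1) (insertPair j x (s p) (t p)) u =
      rootWeight n (x ∘ skipIdx j) u * pairWeight (s p) (t p) u := fun p u => by
    rw [rootWeight_insertPair hj1 hj2, Polynomial.eval_one, one_mul, mul_comm]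
  simp only [e]
  rcases lt_trichotomy (k + 1) j with h | h | h
  · rw [if_neg (by omega)]
    simp only [insertPair_of_ne x _ _ (show k ≠ j by omega) (show k ≠ j + 1 by omega),
      insertPair_of_ne x _ _ (show k + 1 ≠ j by omega) (show k + 1 ≠ j + 1 by omega)]
    refine tendsto_integral_mul_pairWeight_far hf hs ht hst fun hm => ?_
    exact absurd hm.2 (not_le.2 (hξlo _ (by omega) h))
  · rw [if_pos (Or.inl h), h]
    simp only [insertPair_of_ne x _ _ (show k ≠ j by omega) (show k ≠ j + 1 by omega),
      insertPair_self]
    exact tendsto_integral_mul_pairWeight_left hf hfc hs ht hst (hξlo _ hk.1 (by omega))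
  · rcases eq_or_lt_of_le (show j ≤ k by omega) with rfl | h'
    · rw [if_neg (by omega)]
      simp only [insertPair_self, insertPair_succ]
      exact tendsto_integral_mul_pairWeight_mid hfc hs ht hst
    · simp only [insertPair_of_ne x _ _ (show k + 1 ≠ j by omega) (show k + 1 ≠ j + 1 by omega)]
      rcases eq_or_lt_of_le (show j + 1 ≤ k by omega) with rfl | h''
      · rw [if_pos (Or.inr rfl)]
        simp only [insertPair_succ]
        exact tendsto_integral_mul_pairWeight_right hf hfc hs ht hst
          (hξhi _ (by omega) (by omega))
      · rw [if_neg (by omega)]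
        simp only [insertPair_of_ne x _ _ (show k ≠ j by omega) (show k ≠ j + 1 by omega)]
        refine tendsto_integral_mul_pairWeight_far hf hs ht hst fun hm => ?_
        exact absurd hm.1 (not_le.2 (hξhi _ h'' (by omega)))

theorem tendsto_coulombPrefactor (hj1 : 1 ≤ j) (hj2 : j ≤ 2 * n + 1)
    (hs : Filter.Tendsto s l (nhds ξ)) (ht : Filter.Tendsto t l (nhds ξ))
    (hch : ∀ᶠ p in l, IsChamber (n + 1) (insertPair j x (s p) (t p)))
    (hξ : ∀ i ∈ Finset.Icc 1 (2 * n), (x ∘ skipIdx j) i ≠ ξ) :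
    Filter.Tendsto (fun p => coulombPrefactor (n + 1) (insertPair j x (s p) (t p)) /
        (t p - s p) ^ ((4 : ℝ)⁻¹)) l
      (nhds ((rootWeight n (x ∘ skipIdx j) ξ)⁻¹ * coulombPrefactor n (x ∘ skipIdx j))) := by
  have h : Filter.Tendsto (fun p => ∏ i ∈ Finset.Icc 1 (2 * n),
      |s p - x (skipIdx j i)| ^ ((4 : ℝ)⁻¹) * |t p - x (skipIdx j i)| ^ ((4 : ℝ)⁻¹)) l
      (nhds (rootWeight n (x ∘ skipIdx j) ξ)⁻¹) := by
    rw [rootWeight, ← Finset.prod_inv_distrib]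
    refine tendsto_finsetProd _ fun i hi => ?_
    have h0 : |ξ - x (skipIdx j i)| ≠ 0 := (abs_pos.2 (sub_ne_zero.2 (hξ i hi).symm)).ne'
    have e : (|ξ - (x ∘ skipIdx j) i| ^ (-(2 : ℝ)⁻¹))⁻¹ =
        |ξ - x (skipIdx j i)| ^ ((4 : ℝ)⁻¹) * |ξ - x (skipIdx j i)| ^ ((4 : ℝ)⁻¹) := by
      rw [Real.rpow_neg (abs_nonneg _), inv_inv, ← Real.rpow_add' (abs_nonneg _) (by norm_num)]
      norm_num
    rw [e]
    exact ((hs.sub_const _).abs.rpow_const (Or.inl h0)).mul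
      ((ht.sub_const _).abs.rpow_const (Or.inl h0))
  refine (h.mul_const _).congr' ?_
  filter_upwards [hch] with p hp
  have hst := hp j (j + 1) hj1 (by omega) (by omega)
  rw [insertPair_self, insertPair_succ] at hst
  rw [coulombPrefactor_insertPair hj1 hj2 hp, mul_div_cancel_left₀]
  exact (Real.rpow_pos_of_pos (sub_pos.2 hst) _).ne'

/-- The limiting moments of the weight on the `k`-th interval. -/
noncomputable def limitMoment (n j : ℕ) (x : ℕ → ℝ) (ξ : ℝ) (k : ℕ) : Fin (n + 1) → ℝ :=
  Fin.cons (if k + 1 = j ∨ k = j + 1 then rootWeight n (x ∘ skipIdx j) ξ else 0) fun c =>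
    (if k < j then -1 else if k = j then 0 else 1) *
      ∫ u in (insertPair j x ξ ξ k)..(insertPair j x ξ ξ (k + 1)),
        u ^ (c : ℕ) * rootWeight n (x ∘ skipIdx j) u

theorem tendsto_coulomb_insertPair (β : LinkPattern (n + 1)) (hj1 : 1 ≤ j) (hj2 : j ≤ 2 * n + 1)
    (hs : Filter.Tendsto s l (nhds ξ)) (ht : Filter.Tendsto t l (nhds ξ))
    (hch : ∀ᶠ p in l, IsChamber (n + 1) (insertPair j x (s p) (t p)))
    (hy : IsChamber n (x ∘ skipIdx j))
    (hξlo : ∀ i : ℕ, 1 ≤ i → i < j → x i < ξ)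
    (hξhi : ∀ k : ℕ, j + 1 < k → k ≤ 2 * (n + 1) → ξ < x k)
    (hξ : ∀ i ∈ Finset.Icc 1 (2 * n), (x ∘ skipIdx j) i ≠ ξ) :
    Filter.Tendsto (fun p => coulomb (n + 1) β (insertPair j x (s p) (t p)) /
        (((t p - s p) ^ ((4 : ℝ)⁻¹) * |Real.log (t p - s p)| : ℝ) : ℂ)) l
      (nhds ((((rootWeight n (x ∘ skipIdx j) ξ)⁻¹ * coulombPrefactor n (x ∘ skipIdx j) : ℝ) : ℂ) *
        (Complex.I ^ (-∑ r, (β.a r : ℤ)) *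
          Matrix.det (Matrix.of fun r c => ∑ k ∈ Finset.Icc 1 (2 * (n + 1) - 1),
            (if β.a r ≤ k ∧ k < β.b r then Complex.I ^ k else 0) *
              (limitMoment n j x ξ k c : ℂ))))) := by
  have hst : ∀ᶠ p in l, s p < t p := by
    filter_upwards [hch] with p hp
    have hst := hp j (j + 1) hj1 (by omega) (by omega)
    rwa [insertPair_self, insertPair_succ] at hst
  have hL := (tendsto_abs_log_sub_atTop hs ht hst).eventually_gt_atTop 0
  set P : ι → Fin (n + 1) → Polynomial ℝ := fun p =>
    Fin.cons 1 fun c : Fin n => (Polynomial.X - Polynomial.C (s p)) * Polynomial.X ^ (c : ℕ) with hP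
  have hmonic : ∀ p i, (P p i).Monic := by
    intro p i
    refine Fin.cases ?_ (fun c => ?_) i
    · exact Polynomial.monic_one
    · exact (Polynomial.monic_X_sub_C _).mul (Polynomial.monic_X_pow _)
  have hdeg : ∀ p i, (P p i).natDegree = i := by
    intro p i
    refine Fin.cases ?_ (fun c => ?_) i
    · simp [hP]
    · simp only [hP, Fin.cons_succ, Fin.val_succ]
      rw [(Polynomial.monic_X_sub_C _).natDegree_mul (Polynomial.monic_X_pow _),
        Polynomial.natDegree_X_sub_C, Polynomial.natDegree_X_pow, add_comm]
  set v : ι → Fin (n + 1) → ℝ := fun p => Fin.cons |Real.log (t p - s p)| fun _ => 1 with hv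
  set m : ι → ℕ → Fin (n + 1) → ℝ := fun p k c =>
    ∫ u in Set.Ioo (insertPair j x (s p) (t p) k) (insertPair j x (s p) (t p) (k + 1)),
      (P p c).eval u * rootWeight (n + 1) (insertPair j x (s p) (t p)) u with hm
  have hlim : ∀ k ∈ Finset.Icc 1 (2 * (n + 1) - 1), ∀ c,
      Filter.Tendsto (fun p => m p k c / v p c) l (nhds (limitMoment n j x ξ k c)) := by
    intro k hk c
    refine Fin.cases ?_ (fun c => ?_) c
    · simpa only [hm, hv, hP, limitMoment, Fin.cons_zero] using
        tendsto_moment_zero hj1 hj2 hs ht hch hy hξlo hξhi hξ hk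
    · simpa only [hm, hv, hP, limitMoment, Fin.cons_succ, div_one] using
        tendsto_moment_succ hj1 hj2 hs ht hch hy hξ c hk
  have hM : Filter.Tendsto (fun p => Matrix.of fun r c => ∑ k ∈ Finset.Icc 1 (2 * (n + 1) - 1),
      (if β.a r ≤ k ∧ k < β.b r then Complex.I ^ k else 0) * ((m p k c / v p c : ℝ) : ℂ)) l
      (nhds (Matrix.of fun r c => ∑ k ∈ Finset.Icc 1 (2 * (n + 1) - 1),
        (if β.a r ≤ k ∧ k < β.b r then Complex.I ^ k else 0) *
          (limitMoment n j x ξ k c : ℂ))) := by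
    refine tendsto_pi_nhds.2 fun r => tendsto_pi_nhds.2 fun c => ?_
    simp only [Matrix.of_apply]
    refine tendsto_finsetSum _ fun k hk => ?_
    exact ((Complex.continuous_ofReal.tendsto _).comp (hlim k hk c)).const_mul _
  have hdet := ((Continuous.matrix_det (n := Fin (n + 1)) (R := ℂ) continuous_id).tendsto _).comp hM
  have hpre := (Complex.continuous_ofReal.tendsto _).comp
    (tendsto_coulombPrefactor hj1 hj2 hs ht hch hξ)
  refine (hpre.mul (hdet.const_mul (Complex.I ^ (-∑ r, (β.a r : ℤ))))).congr' ?_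
  filter_upwards [hch, hL] with p hp hLp
  rw [coulomb_eq_det β hp (P p) (hdeg p) (hmonic p)]
  have hscale : Matrix.det (Matrix.of fun r c => ∑ k ∈ Finset.Icc 1 (2 * (n + 1) - 1),
      (if β.a r ≤ k ∧ k < β.b r then Complex.I ^ k else 0) * ((m p k c : ℝ) : ℂ)) =
      ((|Real.log (t p - s p)| : ℝ) : ℂ) *
      Matrix.det (Matrix.of fun r c => ∑ k ∈ Finset.Icc 1 (2 * (n + 1) - 1),
      (if β.a r ≤ k ∧ k < β.b r then Complex.I ^ k else 0) * ((m p k c / v p c : ℝ) : ℂ)) := by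
    have e : ∏ c, ((v p c : ℝ) : ℂ) = ((|Real.log (t p - s p)| : ℝ) : ℂ) := by
      rw [Fin.prod_univ_succ]
      simp [hv]
    rw [← e, ← Matrix.det_mul_row]
    congr 1
    ext r c
    simp only [Matrix.of_apply]
    rw [Finset.mul_sum]
    refine Finset.sum_congr rfl fun k _ => ?_
    have hvc : ((v p c : ℝ) : ℂ) ≠ 0 := by
      rw [Complex.ofReal_ne_zero]
      refine Fin.cases ?_ (fun c => ?_) c
      · simpa [hv] using hLp.ne'
      · simp [hv]
    push_cast
    field_simp
  have hLc : ((|Real.log (t p - s p)| : ℝ) : ℂ) ≠ 0 := by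
    rw [Complex.ofReal_ne_zero]; exact hLp.ne'
  simp only [Function.comp_apply, id]
  change _ = _ * (_ * Matrix.det (Matrix.of fun r c => ∑ k ∈ Finset.Icc 1 (2 * (n + 1) - 1),
      (if β.a r ≤ k ∧ k < β.b r then Complex.I ^ k else 0) * ((m p k c : ℝ) : ℂ))) / _
  rw [hscale]
  push_cast
  generalize Matrix.det (R := ℂ) (n := Fin (n + 1)) _ = D
  field_simp

end Limit

/-- The partial sums `∑_{k < m} i ^ k * μ k`. -/
noncomputable def phaseSum (μ : ℕ → ℂ) (m : ℕ) : ℂ := ∑ k ∈ Finset.range m, Complex.I ^ k * μ k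

theorem phaseSum_succ (μ : ℕ → ℂ) (m : ℕ) :
    phaseSum μ (m + 1) = phaseSum μ m + Complex.I ^ m * μ m :=
  Finset.sum_range_succ _ _

theorem sum_ite_I_pow_mul {a b L : ℕ} (ha : 1 ≤ a) (hab : a ≤ b) (hb : b ≤ L + 1) (μ : ℕ → ℂ) :
    ∑ k ∈ Finset.Icc 1 L, (if a ≤ k ∧ k < b then Complex.I ^ k else 0) * μ k =
      phaseSum μ b - phaseSum μ a := by
  rw [phaseSum, phaseSum, ← Finset.sum_Ico_eq_sub _ hab]
  simp only [ite_mul, zero_mul]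
  rw [← Finset.sum_filter]
  refine Finset.sum_congr ?_ fun _ _ => rfl
  ext k
  simp only [Finset.mem_filter, Finset.mem_Icc, Finset.mem_Ico]
  omega

theorem phaseSum_ite {j : ℕ} (hj : 1 ≤ j) (w : ℝ) (m : ℕ) :
    phaseSum (fun k => ((if k + 1 = j ∨ k = j + 1 then w else 0 : ℝ) : ℂ)) m =
      if m = j ∨ m = j + 1 then (w : ℂ) * Complex.I ^ (j - 1) else 0 := by
  obtain ⟨i, rfl⟩ : ∃ i, j = i + 1 := ⟨j - 1, by omega⟩
  rw [Nat.add_sub_cancel]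
  induction m with
  | zero => simp [phaseSum]
  | succ m ih =>
    rw [phaseSum_succ, ih]
    by_cases h1 : m = i
    · subst h1
      rw [if_neg (by omega), if_pos (Or.inl rfl), if_pos (Or.inl rfl), zero_add, mul_comm]
    · by_cases h2 : m = i + 1
      · subst h2
        simp
      · by_cases h3 : m = i + 2
        · subst h3
          simp
          ring_nf
          simp
        · rw [if_neg (by omega), if_neg (by omega), if_neg (by omega)]
          simp

section Skip

variable {j : ℕ} (q : ℕ → ℂ)

theorem phaseSum_sign_of_lt {m : ℕ} (hm : m ≤ j) :
    phaseSum (fun k => ((if k < j then -1 else if k = j then 0 else 1 : ℝ) : ℂ) *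
      (q (k + 1) - q k)) m = -phaseSum (fun k => q (k + 1) - q k) m := by
  rw [phaseSum, phaseSum, ← Finset.sum_neg_distrib]
  refine Finset.sum_congr rfl fun k hk => ?_
  rw [Finset.mem_range] at hk
  rw [if_pos (by omega)]
  push_cast
  ring

theorem phaseSum_sign_succ :
    phaseSum (fun k => ((if k < j then -1 else if k = j then 0 else 1 : ℝ) : ℂ) *
      (q (k + 1) - q k)) (j + 1) =
    phaseSum (fun k => ((if k < j then -1 else if k = j then 0 else 1 : ℝ) : ℂ) *
      (q (k + 1) - q k)) j := by
  rw [phaseSum_succ]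
  simp

theorem phaseSum_comp_skipIdx {m : ℕ} (hm : m < j) :
    phaseSum (fun k => q (skipIdx j (k + 1)) - q (skipIdx j k)) m =
      phaseSum (fun k => q (k + 1) - q k) m := by
  refine Finset.sum_congr rfl fun k hk => ?_
  rw [Finset.mem_range] at hk
  simp only [show skipIdx j (k + 1) = k + 1 from if_pos (by omega),
    show skipIdx j k = k from if_pos (by omega)]

theorem phaseSum_sign_eq (hj : 1 ≤ j) (hq : q j = q (j + 1)) {m : ℕ} (h1 : m ≠ j)
    (h2 : m ≠ j + 1) :
    phaseSum (fun k => ((if k < j then -1 else if k = j then 0 else 1 : ℝ) : ℂ) *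
      (q (k + 1) - q k)) m =
    -phaseSum (fun k => q (skipIdx j (k + 1)) - q (skipIdx j k)) (relabelIdx j m) := by
  rcases lt_or_ge m j with h | h
  · rw [phaseSum_sign_of_lt q h.le, relabelIdx, if_pos h, phaseSum_comp_skipIdx q h]
  · obtain ⟨d, rfl⟩ : ∃ d, m = j + 2 + d := ⟨m - (j + 2), by omega⟩
    rw [relabelIdx, if_neg (by omega), show j + 2 + d - 2 = j + d by omega]
    clear h h1 h2
    induction d with
    | zero =>
      rw [add_zero, add_zero, phaseSum_succ, phaseSum_sign_succ, phaseSum_sign_of_lt q le_rfl]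
      obtain ⟨i, rfl⟩ : ∃ i, j = i + 1 := ⟨j - 1, by omega⟩
      rw [phaseSum_succ, phaseSum_succ, phaseSum_comp_skipIdx q (Nat.lt_succ_self i)]
      simp only [skipIdx, lt_irrefl, if_false, lt_add_one, if_true]
      rw [if_neg (by omega), if_neg (by omega), ← hq, show i + 1 + 2 = i + 1 + 1 + 1 by omega]
      push_cast
      rw [pow_succ _ (i + 1), pow_succ]
      linear_combination Complex.I ^ i * (q (i + 1 + 1 + 1) - q (i + 1)) * Complex.I_mul_I
    | succ d ih =>
      rw [← add_assoc, ← add_assoc, phaseSum_succ, phaseSum_succ, ih]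
      simp only [skipIdx]
      rw [if_neg (by omega), if_neg (by omega), if_neg (by omega), if_neg (by omega),
        show j + d + 1 + 2 = j + 2 + d + 1 by omega, show j + d + 2 = j + 2 + d by omega,
        show j + 2 + d = j + d + 2 by omega, pow_add, Complex.I_sq]
      push_cast
      ring

end Skip

theorem exists_primitive {n : ℕ} {y : ℕ → ℝ} (hy : IsChamber n y) (c : ℕ) :
    ∃ Q : ℝ → ℝ, ∀ a b, ∫ u in a..b, u ^ c * rootWeight n y u = Q b - Q a := by
  have hloc : ∀ a b, IntervalIntegrable (fun u => u ^ c * rootWeight n y u) volume a b :=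
    fun a b => intervalIntegrable_iff.2
      (((locallyIntegrable_pow_mul_rootWeight hy c).integrableOn_isCompact
        isCompact_uIcc).mono_set Set.uIoc_subset_uIcc)
  exact ⟨fun v => ∫ u in (0 : ℝ)..v, u ^ c * rootWeight n y u, fun a b =>
    (intervalIntegral.integral_interval_sub_left (hloc _ _) (hloc _ _)).symm⟩

theorem LinkPattern.one_le_a {N : ℕ} (β : LinkPattern N) (r : Fin N) : 1 ≤ β.a r :=
  ((β.cover _).1 ⟨(r, false), rfl⟩).1

theorem LinkPattern.b_le {N : ℕ} (β : LinkPattern N) (r : Fin N) : β.b r ≤ 2 * N :=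
  ((β.cover _).1 ⟨(r, true), rfl⟩).2

theorem coulomb_eq_det_phaseSum {n : ℕ} (δ : LinkPattern n) {y : ℕ → ℝ} (hy : IsChamber n y)
    (Q : Fin n → ℝ → ℝ)
    (hQ : ∀ (c : Fin n) (a b : ℝ), ∫ u in a..b, u ^ (c : ℕ) * rootWeight n y u = Q c b - Q c a) :
    coulomb n δ y = (coulombPrefactor n y : ℂ) * (Complex.I ^ (-∑ r, (δ.a r : ℤ)) *
      Matrix.det (Matrix.of fun r c =>
        phaseSum (fun k => (Q c (y (k + 1)) : ℂ) - Q c (y k)) (δ.b r) -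
        phaseSum (fun k => (Q c (y (k + 1)) : ℂ) - Q c (y k)) (δ.a r))) := by
  rw [coulomb_eq_det δ hy (fun c => Polynomial.X ^ (c : ℕ)) (fun c => Polynomial.natDegree_X_pow _)
    (fun c => Polynomial.monic_X_pow _)]
  congr 3
  ext r c
  have := δ.b_le r
  have := (δ.a_lt_b r)
  simp only [Matrix.of_apply]
  rw [← sum_ite_I_pow_mul (δ.one_le_a r) (δ.a_lt_b r).le (L := 2 * n - 1) (by omega)]
  refine Finset.sum_congr rfl fun k hk => ?_
  rw [Finset.mem_Icc] at hk
  rw [← Complex.ofReal_sub, ← hQ, intervalIntegral.integral_of_le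
    (hy k (k + 1) hk.1 (by omega) (by omega)).le, integral_Ioc_eq_integral_Ioo]
  simp only [Polynomial.eval_pow, Polynomial.eval_X, rootWeight]

section Determinant

theorem det_eq_of_column_zero {n : ℕ} (M : Matrix (Fin (n + 1)) (Fin (n + 1)) ℂ)
    (Z : Matrix (Fin n) (Fin n) ℂ) (R S : Fin (n + 1)) (ε : ℂ) (hRS : R ≠ S)
    (h0 : ∀ r, r ≠ R → r ≠ S → M r 0 = 0) (hS : M S 0 + ε * M R 0 = 0)
    (hZ : ∀ t c, M (R.succAbove t) c.succ +
      (if R.succAbove t = S then ε * M R c.succ else 0) = -Z t c) :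
    M.det = (-1) ^ ((R : ℕ) + n) * M R 0 * Z.det := by
  rw [← Matrix.det_updateRow_add_smul_self M hRS.symm ε, Matrix.det_succ_column_zero,
    Finset.sum_eq_single R]
  · rw [Matrix.updateRow_ne hRS]
    have e : (M.updateRow S (M S + ε • M R)).submatrix R.succAbove Fin.succ = -Z := by
      ext t c
      rw [Matrix.neg_apply, ← hZ t c, Matrix.submatrix_apply]
      by_cases h : R.succAbove t = S
      · rw [h, Matrix.updateRow_self, if_pos rfl]
        rfl
      · rw [Matrix.updateRow_ne h, if_neg h, add_zero]
    rw [e, Matrix.det_neg, Fintype.card_fin]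
    ring
  · intro r _ hr
    by_cases h : r = S
    · rw [h, Matrix.updateRow_self]
      rw [show (M S + ε • M R) 0 = M S 0 + ε * M R 0 from rfl, hS]
      ring
    · rw [Matrix.updateRow_ne h, h0 r hr h]
      ring
  · simp

end Determinant

namespace LinkPattern

variable {N : ℕ} (β : LinkPattern N)

theorem a_injective : Function.Injective β.a := β.a_mono.injective

theorem b_injective : Function.Injective β.b := fun r s h => by
  have := β.inj (a₁ := (r, true)) (a₂ := (s, true)) (by simpa using h)
  simpa using this

theorem a_ne_b (r s : Fin N) : β.a r ≠ β.b s := fun h => by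
  have := β.inj (a₁ := (r, false)) (a₂ := (s, true)) (by simpa using h)
  simp at this

theorem exists_a_or_b {k : ℕ} (h1 : 1 ≤ k) (h2 : k ≤ 2 * N) : ∃ r, β.a r = k ∨ β.b r = k := by
  obtain ⟨⟨r, t⟩, h⟩ := (β.cover k).2 ⟨h1, h2⟩
  cases t
  · exact ⟨r, Or.inl (by simpa using h)⟩
  · exact ⟨r, Or.inr (by simpa using h)⟩

/-- The sites strictly below a link are matched among themselves. -/
theorem two_mul_card_nested (r : Fin N) :
    2 * (Finset.univ.filter fun s => β.a r < β.a s ∧ β.a s < β.b r).card + β.a r + 1 =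
      β.b r := by
  set F := Finset.univ.filter fun s => β.a r < β.a s ∧ β.a s < β.b r with hF
  have e : Finset.Ioo (β.a r) (β.b r) = F.image β.a ∪ F.image β.b := by
    ext k
    simp only [Finset.mem_Ioo, Finset.mem_union, Finset.mem_image, hF, Finset.mem_filter,
      Finset.mem_univ, true_and]
    constructor
    · rintro ⟨h1, h2⟩
      obtain ⟨s, rfl | rfl⟩ := β.exists_a_or_b (k := k) (by omega)
        (h2.le.trans (β.b_le r))
      · exact Or.inl ⟨s, ⟨h1, h2⟩, rfl⟩
      · refine Or.inr ⟨s, ⟨?_, (β.a_lt_b s).trans h2⟩, rfl⟩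
        by_contra h
        rcases (not_lt.1 h).lt_or_eq with h | h
        · exact β.noncross s r ⟨h, h1, h2⟩
        · rw [β.a_injective h] at h2
          exact lt_irrefl _ h2
    · rintro (⟨s, hs, rfl⟩ | ⟨s, hs, rfl⟩)
      · exact hs
      · refine ⟨hs.1.trans (β.a_lt_b s), ?_⟩
        by_contra h
        rcases (not_lt.1 h).lt_or_eq with h | h
        · exact β.noncross r s ⟨hs.1, hs.2, h⟩
        · rw [β.b_injective h] at hs
          exact lt_irrefl _ hs.1
  have hd : Disjoint (F.image β.a) (F.image β.b) := by
    rw [Finset.disjoint_left]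
    intro k h1 h2
    obtain ⟨s, _, rfl⟩ := Finset.mem_image.1 h1
    obtain ⟨s', _, h⟩ := Finset.mem_image.1 h2
    exact β.a_ne_b _ _ h.symm
  have hc := congrArg Finset.card e
  rw [Nat.card_Ioo, Finset.card_union_of_disjoint hd,
    Finset.card_image_of_injective _ β.a_injective,
    Finset.card_image_of_injective _ β.b_injective] at hc
  have := β.a_lt_b r
  omega

theorem eq_of_linked {p q : ℕ} (h : β.Linked p q) (hpq : p < q) :
    ∃ r, β.a r = p ∧ β.b r = q := by
  obtain ⟨r, h | h⟩ := h
  · exact ⟨r, h⟩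
  · have := β.a_lt_b r
    omega

/-- Reordering the rows of a determinant indexed by the links of a pattern. -/
theorem det_of_reorder (z : ℕ → Fin N → ℂ) (A B : Fin N → ℕ) (hA : Function.Injective A)
    (hAB : ∀ t, A t < B t) (hl : ∀ t, β.Linked (A t) (B t)) :
    Matrix.det (Matrix.of fun t c => z (B t) c - z (A t) c) =
      ((∏ t, ∏ s ∈ Finset.Iio t, (if A s < A t then 1 else -1 : ℤˣ) : ℤˣ) : ℤ) *
        Matrix.det (Matrix.of fun t c => z (β.b t) c - z (β.a t) c) ∧
    ∑ t, (β.a t : ℤ) = ∑ t, (A t : ℤ) := by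
  choose e he using fun t => β.eq_of_linked (hl t) (hAB t)
  have hinj : Function.Injective e := fun s t h => hA (by rw [← (he s).1, ← (he t).1, h])
  set σ : Equiv.Perm (Fin N) := Equiv.ofBijective e (Finite.injective_iff_bijective.1 hinj) with hσ
  have hσe : ∀ t, σ t = e t := fun t => rfl
  constructor
  · have hs : (∏ t, ∏ s ∈ Finset.Iio t, (if A s < A t then 1 else -1 : ℤˣ)) =
        Equiv.Perm.sign σ := by
      rw [Equiv.Perm.sign_eq_prod_prod_Iio]
      refine Finset.prod_congr rfl fun t _ => Finset.prod_congr rfl fun s _ => ?_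
      simp only [hσe, ← (he s).1, ← (he t).1, β.a_mono.lt_iff_lt]
    rw [hs, ← Matrix.det_permute]
    congr 1
    ext t c
    simp [hσe, he]
  · rw [← Equiv.sum_comp σ]
    exact Finset.sum_congr rfl fun t _ => by rw [hσe, (he t).1]

end LinkPattern

theorem relabelIdx_lt_iff {j p q : ℕ} (hp : p ≠ j ∧ p ≠ j + 1) (hq : q ≠ j ∧ q ≠ j + 1) :
    relabelIdx j p < relabelIdx j q ↔ p < q := by
  unfold relabelIdx; split_ifs <;> omega

theorem relabelIdx_inj {j p q : ℕ} (hp : p ≠ j ∧ p ≠ j + 1) (hq : q ≠ j ∧ q ≠ j + 1) :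
    relabelIdx j p = relabelIdx j q ↔ p = q := by
  unfold relabelIdx; split_ifs <;> omega

/-- The opening sites obtained by replacing that of the link `S` with `P` and omitting the
link `R`. -/
def mergedOpening {n : ℕ} (β : LinkPattern (n + 1)) (R S : Fin (n + 1)) (P : ℕ) (t : Fin n) : ℕ :=
  if R.succAbove t = S then P else β.a (R.succAbove t)

section Merge

variable {n j : ℕ} (β : LinkPattern (n + 1)) {R S : Fin (n + 1)} {P Q : ℕ}

theorem ends_ne {u : Fin (n + 1)}
    (hj : j = β.a R ∨ j = β.b R ∨ j = β.a S ∨ j = β.b S) (h1 : u ≠ R) (h2 : u ≠ S) :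
    β.a u ≠ j ∧ β.b u ≠ j := by
  have e1 := β.a_injective.ne h1
  have e2 := β.a_injective.ne h2
  have e3 := β.b_injective.ne h1
  have e4 := β.b_injective.ne h2
  have e5 := β.a_ne_b
  rcases hj with rfl | rfl | rfl | rfl
  · exact ⟨e1, (e5 _ _).symm⟩
  · exact ⟨e5 _ _, e3⟩
  · exact ⟨e2, (e5 _ _).symm⟩
  · exact ⟨e5 _ _, e4⟩

theorem det_eq_of_merge (δ : LinkPattern n) (hRS : R ≠ S) (ε : ℂ)
    (hP : P = β.a R ∨ P = β.b R ∨ P = β.a S ∨ P = β.b S)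
    (hj : j = β.a R ∨ j = β.b R ∨ j = β.a S ∨ j = β.b S)
    (hj' : j + 1 = β.a R ∨ j + 1 = β.b R ∨ j + 1 = β.a S ∨ j + 1 = β.b S)
    (hPj : P ≠ j ∧ P ≠ j + 1) (hQj : Q ≠ j ∧ Q ≠ j + 1) (hPQ : P < Q)
    (hl : ∀ u, β.a u ≠ j → β.a u ≠ j + 1 → β.b u ≠ j → β.b u ≠ j + 1 →
      δ.Linked (relabelIdx j (β.a u)) (relabelIdx j (β.b u)))
    (hl' : δ.Linked (relabelIdx j P) (relabelIdx j Q))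
    (V : ℕ → Fin (n + 1) → ℂ) (z : ℕ → Fin n → ℂ)
    (h0 : ∀ k, k ≠ j → k ≠ j + 1 → V k 0 = 0)
    (hz : ∀ k, k ≠ j → k ≠ j + 1 → ∀ c : Fin n, V k c.succ = -z (relabelIdx j k) c)
    (hS : V (β.b S) 0 - V (β.a S) 0 + ε * (V (β.b R) 0 - V (β.a R) 0) = 0)
    (hSc : ∀ c : Fin n, V (β.b S) c.succ - V (β.a S) c.succ +
      ε * (V (β.b R) c.succ - V (β.a R) c.succ) = V Q c.succ - V P c.succ) :
    Matrix.det (Matrix.of fun r c => V (β.b r) c - V (β.a r) c) =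
      (-1) ^ ((R : ℕ) + n) * (V (β.b R) 0 - V (β.a R) 0) *
      ((((∏ t, ∏ s ∈ Finset.Iio t,
        (if mergedOpening β R S P s < mergedOpening β R S P t then 1 else -1 : ℤˣ) : ℤˣ) : ℤ) : ℂ) *
        Matrix.det (Matrix.of fun t c => z (δ.b t) c - z (δ.a t) c)) ∧
    ∑ t, (δ.a t : ℤ) = ∑ t, (relabelIdx j (mergedOpening β R S P t) : ℤ) := by
  have hne : ∀ u, u ≠ R → u ≠ S → (β.a u ≠ j ∧ β.a u ≠ j + 1) ∧ β.b u ≠ j ∧ β.b u ≠ j + 1 :=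
    fun u h1 h2 => ⟨⟨(ends_ne β hj h1 h2).1, (ends_ne β hj' h1 h2).1⟩,
      (ends_ne β hj h1 h2).2, (ends_ne β hj' h1 h2).2⟩
  have hmer : ∀ t, mergedOpening β R S P t ≠ j ∧ mergedOpening β R S P t ≠ j + 1 := by
    intro t
    unfold mergedOpening
    split_ifs with h
    exacts [hPj, (hne _ (R.succAbove_ne t) h).1]
  have hinj : Function.Injective fun t => relabelIdx j (mergedOpening β R S P t) := by
    intro t t' h
    have h := (relabelIdx_inj (hmer t) (hmer t')).1 h
    unfold mergedOpening at h
    split_ifs at h with h1 h2 h2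
    · exact Fin.succAbove_right_injective (h1.trans h2.symm)
    · exact absurd h.symm (ends_ne β hP (R.succAbove_ne t') h2).1
    · exact absurd h (ends_ne β hP (R.succAbove_ne t) h1).1
    · exact Fin.succAbove_right_injective (β.a_injective h)
  set B : Fin n → ℕ := fun t => relabelIdx j
    (if R.succAbove t = S then Q else β.b (R.succAbove t)) with hB
  have hAB : ∀ t, relabelIdx j (mergedOpening β R S P t) < B t := by
    intro t
    simp only [hB, mergedOpening]
    split_ifs with h
    · exact (relabelIdx_lt_iff hPj hQj).2 hPQ
    · have := hne _ (R.succAbove_ne t) h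
      exact (relabelIdx_lt_iff this.1 this.2).2 (β.a_lt_b _)
  have hlink : ∀ t, δ.Linked (relabelIdx j (mergedOpening β R S P t)) (B t) := by
    intro t
    simp only [hB, mergedOpening]
    split_ifs with h
    · exact hl'
    · have := hne _ (R.succAbove_ne t) h
      exact hl _ this.1.1 this.1.2 this.2.1 this.2.2
  obtain ⟨hd, hsum⟩ := δ.det_of_reorder z _ B hinj hAB hlink
  refine ⟨?_, hsum⟩
  simp only [relabelIdx_lt_iff (hmer _) (hmer _)] at hd
  rw [← hd]
  refine det_eq_of_column_zero _ _ R S ε hRS ?_ hS ?_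
  · intro r h1 h2
    have := hne r h1 h2
    rw [Matrix.of_apply, h0 _ this.1.1 this.1.2, h0 _ this.2.1 this.2.2, sub_zero]
  · intro t c
    simp only [Matrix.of_apply, hB, mergedOpening]
    split_ifs with h
    · rw [h, hSc, hz _ hPj.1 hPj.2, hz _ hQj.1 hQj.2]
      ring
    · have := hne _ (R.succAbove_ne t) h
      rw [hz _ this.1.1 this.1.2, hz _ this.2.1 this.2.2]
      ring

theorem sum_a_eq (hRS : R ≠ S) (hR : β.a R ≤ j + 1) (hS : β.a S ≤ j + 1)
    (hne : ∀ u, u ≠ R → u ≠ S → β.a u ≠ j ∧ β.a u ≠ j + 1) :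
    ∑ r, (β.a r : ℤ) = β.a R + (∑ t, (relabelIdx j (mergedOpening β R S P t) : ℤ)) +
      2 * ((Finset.univ.filter fun r => j + 1 < β.a r).card : ℤ) +
      (β.a S - relabelIdx j P) := by
  obtain ⟨t₀, ht₀⟩ := Fin.exists_succAbove_eq hRS.symm
  have hpt : ∀ t, (β.a (R.succAbove t) : ℤ) = relabelIdx j (mergedOpening β R S P t) +
      2 * (if j + 1 < β.a (R.succAbove t) then 1 else 0) +
      (if t = t₀ then (β.a S : ℤ) - relabelIdx j P else 0) := by
    intro t
    by_cases h : t = t₀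
    · rw [h, mergedOpening, ht₀, if_pos rfl, if_neg (by omega), if_pos rfl]
      ring
    · have h' : R.succAbove t ≠ S := fun e =>
        h (Fin.succAbove_right_injective (e.trans ht₀.symm))
      have := hne _ (R.succAbove_ne t) h'
      rw [mergedOpening, if_neg h', if_neg h, relabelIdx]
      split_ifs <;> omega
  have hG : ((Finset.univ.filter fun r => j + 1 < β.a r).card : ℤ) =
      ∑ t, if j + 1 < β.a (R.succAbove t) then (1 : ℤ) else 0 := by
    rw [Finset.card_filter, Fin.sum_univ_succAbove _ R, if_neg (by omega)]
    push_cast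
    ring
  rw [Fin.sum_univ_succAbove _ R, Finset.sum_congr rfl fun t _ => hpt t,
    Finset.sum_add_distrib, Finset.sum_add_distrib, ← Finset.mul_sum, ← hG,
    Finset.sum_ite_eq' Finset.univ t₀, if_pos (Finset.mem_univ _)]
  ring

theorem prod_sign_mergedOpening_of_eq (hP : P = β.a S) :
    (∏ t, ∏ s ∈ Finset.Iio t,
      (if mergedOpening β R S P s < mergedOpening β R S P t then 1 else -1 : ℤˣ)) = 1 := by
  have e : ∀ t, mergedOpening β R S P t = β.a (R.succAbove t) := by
    intro t
    unfold mergedOpening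
    split_ifs with h
    · rw [h, hP]
    · rfl
  refine Finset.prod_eq_one fun t _ => Finset.prod_eq_one fun s hs => ?_
  rw [Finset.mem_Iio] at hs
  rw [if_pos]
  rw [e, e]
  exact β.a_mono (Fin.strictMono_succAbove R hs)

theorem prod_sign_mergedOpening (hRS : R ≠ S) (hR : β.a R = j + 1) (hS : β.a S = j)
    (hP : P = β.b R) :
    (∏ t, ∏ s ∈ Finset.Iio t,
      (if mergedOpening β R S P s < mergedOpening β R S P t then 1 else -1 : ℤˣ)) =
    (-1) ^ (Finset.univ.filter fun s => β.a R < β.a s ∧ β.a s < β.b R).card := by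
  obtain ⟨t₀, ht₀⟩ := Fin.exists_succAbove_eq hRS.symm
  have hlt := β.a_lt_b R
  have hm := Fin.strictMono_succAbove R
  have hS' : ∀ t, R.succAbove t = S ↔ t = t₀ := fun t =>
    ⟨fun h => hm.injective (h.trans ht₀.symm), fun h => h ▸ ht₀⟩
  have hpt : ∀ t, ∏ s ∈ Finset.Iio t,
      (if mergedOpening β R S P s < mergedOpening β R S P t then 1 else -1 : ℤˣ) =
      if t₀ < t ∧ β.a (R.succAbove t) < P then -1 else 1 := by
    intro t
    have : ∀ s ∈ Finset.Iio t,
        (if mergedOpening β R S P s < mergedOpening β R S P t then 1 else -1 : ℤˣ) =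
        if s = t₀ then (if β.a (R.succAbove t) < P then -1 else 1) else 1 := by
      intro s hs
      rw [Finset.mem_Iio] at hs
      have hst := β.a_mono (hm hs)
      simp only [mergedOpening, hS']
      by_cases h1 : s = t₀
      · have h2 : t ≠ t₀ := fun h => by rw [h1, h] at hs; exact lt_irrefl _ hs
        have h3 := β.a_ne_b (R.succAbove t) R
        rw [if_pos h1, if_pos h1, if_neg h2]
        by_cases h4 : β.a (R.succAbove t) < P
        · rw [if_pos h4, if_neg (by omega)]
        · rw [if_neg h4, if_pos (by omega)]
      · rw [if_neg h1, if_neg h1]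
        by_cases h2 : t = t₀
        · rw [if_pos h2, if_pos]
          rw [h2, ht₀] at hst
          omega
        · rw [if_neg h2, if_pos hst]
    rw [Finset.prod_congr rfl this, Finset.prod_ite_eq']
    simp only [Finset.mem_Iio]
    split_ifs <;> first | rfl | (exfalso; tauto)
  rw [Finset.prod_congr rfl fun t _ => hpt t, Finset.prod_ite, Finset.prod_const_one, mul_one,
    Finset.prod_const]
  congr 1
  rw [← Finset.card_map R.succAboveEmb]
  congr 1
  ext r
  simp only [Finset.mem_map, Finset.mem_filter, Finset.mem_univ, true_and, Fin.coe_succAboveEmb]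
  constructor
  · rintro ⟨t, ⟨h1, h2⟩, rfl⟩
    have h3 := β.a_mono (hm h1)
    have h4 := β.a_injective.ne (R.succAbove_ne t)
    rw [ht₀] at h3
    exact ⟨by omega, by omega⟩
  · rintro ⟨h1, h2⟩
    obtain ⟨t, rfl⟩ := Fin.exists_succAbove_eq (x := r) (y := R) (fun h => by
      rw [h] at h1; exact lt_irrefl _ h1)
    refine ⟨t, ⟨?_, by omega⟩, rfl⟩
    rw [← hm.lt_iff_lt, ht₀, ← β.a_mono.lt_iff_lt]
    omega

theorem card_lt_a (R : Fin (n + 1)) :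
    (Finset.univ.filter fun r => β.a R < β.a r).card + R = n := by
  have : (Finset.univ.filter fun r => β.a R < β.a r) = Finset.Ioi R := by
    ext r
    simp [β.a_mono.lt_iff_lt]
  rw [this, Fin.card_Ioi]
  omega

end Merge

theorem I_zpow_neg_mul_pow {s s' m : ℤ} {i : ℕ} (h : -s + i = -s' + 2 * m) :
    Complex.I ^ (-s) * Complex.I ^ i = Complex.I ^ (-s') * (-1) ^ m := by
  rw [← zpow_natCast, ← zpow_add₀ Complex.I_ne_zero, h, zpow_add₀ Complex.I_ne_zero, zpow_mul]
  congr 2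
  rw [← Complex.I_sq]
  norm_cast

theorem mul_signs_cancel {A B C w D : ℂ} {m : ℤ} {k e : ℕ} (hI : A * B = C * (-1) ^ m)
    (h : Even (m + k + e)) :
    A * ((-1) ^ k * (w * B) * ((-1) ^ e * D)) = w * (C * D) := by
  have h1 : (-1 : ℂ) ^ m * (-1) ^ k * (-1) ^ e = 1 := by
    rw [← zpow_natCast, ← zpow_natCast, ← zpow_add₀ (by norm_num), ← zpow_add₀ (by norm_num)]
    exact h.neg_one_zpow
  linear_combination (w * D * (-1) ^ k * (-1) ^ e) * hI + C * w * D * h1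

section Tie

variable {n j : ℕ} (β : LinkPattern (n + 1)) (δ : LinkPattern n) {w : ℂ}
  (V : ℕ → Fin (n + 1) → ℂ) (z : ℕ → Fin n → ℂ)

theorem det_tie (hj1 : 1 ≤ j) (hlink : ¬ β.Linked j (j + 1)) (hδ : IsTieReduction (n + 1) β j δ)
    (h0 : ∀ k, V k 0 = if k = j ∨ k = j + 1 then w * Complex.I ^ (j - 1) else 0)
    (hV : ∀ c : Fin n, V (j + 1) c.succ = V j c.succ)
    (hz : ∀ k, k ≠ j → k ≠ j + 1 → ∀ c : Fin n, V k c.succ = -z (relabelIdx j k) c) :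
    Complex.I ^ (-∑ r, (β.a r : ℤ)) *
      Matrix.det (Matrix.of fun r c => V (β.b r) c - V (β.a r) c) =
    w * (Complex.I ^ (-∑ r, (δ.a r : ℤ)) *
      Matrix.det (Matrix.of fun r c => z (δ.b r) c - z (δ.a r) c)) := by
  obtain ⟨l1, l2, ⟨r1, h1⟩, ⟨r2, h2⟩, hδ⟩ := hδ
  have hl : ∀ u, β.a u ≠ j → β.a u ≠ j + 1 → β.b u ≠ j → β.b u ≠ j + 1 →
      δ.Linked (relabelIdx j (β.a u)) (relabelIdx j (β.b u)) := fun u e1 e2 e3 e4 =>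
    (hδ _ _).2 (Or.inl ⟨_, _, ⟨u, Or.inl ⟨rfl, rfl⟩⟩, e1, e2, e3, e4, rfl, rfl⟩)
  have hl12 : δ.Linked (relabelIdx j l1) (relabelIdx j l2) := (hδ _ _).2 (Or.inr (Or.inl ⟨rfl, rfl⟩))
  have hl21 : δ.Linked (relabelIdx j l2) (relabelIdx j l1) := (hδ _ _).2 (Or.inr (Or.inr ⟨rfl, rfl⟩))
  have hz0 : ∀ k, k ≠ j → k ≠ j + 1 → V k 0 = 0 := fun k e1 e2 => by
    rw [h0, if_neg (by omega)]
  have hj0 : V j 0 = w * Complex.I ^ (j - 1) := by rw [h0, if_pos (Or.inl rfl)]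
  have hj0' : V (j + 1) 0 = w * Complex.I ^ (j - 1) := by rw [h0, if_pos (Or.inr rfl)]
  have hr : r1 ≠ r2 := by
    rintro rfl
    have := β.a_lt_b r1
    exact hlink ⟨r1, by omega⟩
  have t1 := β.a_lt_b r1
  have t2 := β.a_lt_b r2
  have n1 := β.a_ne_b r1 r2
  have n2 := β.a_ne_b r2 r1
  have n3 := β.a_injective.ne hr
  have n4 := β.b_injective.ne hr
  rcases h1 with ⟨e1, e2⟩ | ⟨e1, e2⟩ <;> rcases h2 with ⟨e3, e4⟩ | ⟨e3, e4⟩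
  · have hlt : l2 < l1 := by
      have := β.noncross r1 r2
      omega
    obtain ⟨hd, hs⟩ := det_eq_of_merge (j := j) (R := r2) (S := r1) (P := l2) (Q := l1) β δ hr.symm
      (-1) (by omega) (by omega) (by omega) (by omega) (by omega) hlt hl hl21 V z hz0 hz
      (by rw [e1, e3, hj0, hj0', hz0 _ (by omega) (by omega), hz0 _ (by omega) (by omega)]; ring)
      (fun c => by rw [e1, e2, e3, e4, hV]; ring)
    have hsum := sum_a_eq (j := j) (R := r2) (S := r1) (P := l2) β hr.symm (by omega) (by omega)
      (fun u a b => ⟨(ends_ne β (by omega) a b).1, (ends_ne β (by omega) a b).1⟩)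
    rw [prod_sign_mergedOpening β hr.symm e3 e1 e4.symm] at hd
    have hq := β.two_mul_card_nested r2
    have hG := card_lt_a β r2
    rw [e3] at hG
    set G := (Finset.univ.filter fun r => j + 1 < β.a r).card
    set q := (Finset.univ.filter fun s => β.a r2 < β.a s ∧ β.a s < β.b r2).card
    rw [hd, e3, e4, hj0', hz0 l2 (by omega) (by omega)]
    have hI := I_zpow_neg_mul_pow (s := ∑ r, (β.a r : ℤ)) (s' := ∑ r, (δ.a r : ℤ)) (i := j - 1)
      (m := q - G - 1) (by
        rw [hsum, hs, relabelIdx, if_neg (by omega)]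
        omega)
    rw [← mul_signs_cancel hI (k := (r2 : ℕ) + n) (e := q + 1) ⟨q + r2, by push_cast; omega⟩]
    push_cast
    ring
  · have := β.noncross r2 r1
    omega
  · obtain ⟨hd, hs⟩ := det_eq_of_merge (j := j) (R := r2) (S := r1) (P := l1) (Q := l2) β δ hr.symm
      1 (by omega) (by omega) (by omega) (by omega) (by omega) (by omega) hl hl12 V z hz0 hz
      (by rw [e2, e3, hj0, hj0', hz0 _ (by omega) (by omega), hz0 _ (by omega) (by omega)]; ring)
      (fun c => by rw [e1, e2, e3, e4, hV]; ring)
    have hsum := sum_a_eq (j := j) (R := r2) (S := r1) (P := l1) β hr.symm (by omega) (by omega)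
      (fun u a b => ⟨(ends_ne β (by omega) a b).1, (ends_ne β (by omega) a b).1⟩)
    rw [prod_sign_mergedOpening_of_eq β e1.symm] at hd
    have hG := card_lt_a β r2
    rw [e3] at hG
    set G := (Finset.univ.filter fun r => j + 1 < β.a r).card
    rw [hd, e3, e4, hj0', hz0 l2 (by omega) (by omega)]
    have hI := I_zpow_neg_mul_pow (s := ∑ r, (β.a r : ℤ)) (s' := ∑ r, (δ.a r : ℤ)) (i := j - 1)
      (m := - G - 1) (by
        rw [hsum, hs, relabelIdx, if_pos (by omega)]
        omega)
    rw [← mul_signs_cancel hI (k := (r2 : ℕ) + n) (e := 1) ⟨r2, by push_cast; omega⟩]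
    push_cast
    ring
  · have hlt : l2 < l1 := by
      have := β.noncross r1 r2
      omega
    obtain ⟨hd, hs⟩ := det_eq_of_merge (j := j) (R := r1) (S := r2) (P := l2) (Q := l1) β δ hr
      (-1) (by omega) (by omega) (by omega) (by omega) (by omega) hlt hl hl21 V z hz0 hz
      (by rw [e2, e4, hj0, hj0', hz0 _ (by omega) (by omega), hz0 _ (by omega) (by omega)]; ring)
      (fun c => by rw [e1, e2, e3, e4, hV]; ring)
    have hsum := sum_a_eq (j := j) (R := r1) (S := r2) (P := l2) β hr (by omega) (by omega)
      (fun u a b => ⟨(ends_ne β (by omega) a b).1, (ends_ne β (by omega) a b).1⟩)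
    rw [prod_sign_mergedOpening_of_eq β e3.symm] at hd
    have hq := β.two_mul_card_nested r1
    have hG := card_lt_a β r1
    have hcard : (Finset.univ.filter fun r => β.a r1 < β.a r).card =
        (Finset.univ.filter fun s => β.a r1 < β.a s ∧ β.a s < β.b r1).card +
          (Finset.univ.filter fun r => j + 1 < β.a r).card := by
      rw [← Finset.card_union_of_disjoint]
      · congr 1
        ext r
        simp only [Finset.mem_union, Finset.mem_filter, Finset.mem_univ, true_and]
        have := β.a_ne_b r r1
        have := β.a_ne_b r r2
        omega
      · rw [Finset.disjoint_filter]
        omega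
    rw [hcard] at hG
    set G := (Finset.univ.filter fun r => j + 1 < β.a r).card
    set q := (Finset.univ.filter fun s => β.a r1 < β.a s ∧ β.a s < β.b r1).card
    rw [hd, e1, e2, hj0, hz0 l1 (by omega) (by omega)]
    have hI := I_zpow_neg_mul_pow (s := ∑ r, (β.a r : ℤ)) (s' := ∑ r, (δ.a r : ℤ)) (i := j - 1)
      (m := q - G) (by
        rw [hsum, hs, relabelIdx, if_pos (by omega)]
        omega)
    rw [← mul_signs_cancel hI (k := (r1 : ℕ) + n) (e := 0) ⟨q + r1, by push_cast; omega⟩]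
    push_cast
    ring

end Tie

theorem det_limitMoment {n j : ℕ} {x : ℕ → ℝ} {ξ : ℝ} (β : LinkPattern (n + 1))
    (δ : LinkPattern n) (hj1 : 1 ≤ j) (hlink : ¬ β.Linked j (j + 1))
    (hδ : IsTieReduction (n + 1) β j δ) (Q : Fin n → ℝ → ℝ)
    (hQ : ∀ (c : Fin n) (a b : ℝ),
      ∫ u in a..b, u ^ (c : ℕ) * rootWeight n (x ∘ skipIdx j) u = Q c b - Q c a) :
    Complex.I ^ (-∑ r, (β.a r : ℤ)) *
      Matrix.det (Matrix.of fun r c => ∑ k ∈ Finset.Icc 1 (2 * (n + 1) - 1),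
        (if β.a r ≤ k ∧ k < β.b r then Complex.I ^ k else 0) * (limitMoment n j x ξ k c : ℂ)) =
    (rootWeight n (x ∘ skipIdx j) ξ : ℂ) * (Complex.I ^ (-∑ r, (δ.a r : ℤ)) *
      Matrix.det (Matrix.of fun r c =>
        phaseSum (fun k => (Q c ((x ∘ skipIdx j) (k + 1)) : ℂ) - Q c ((x ∘ skipIdx j) k)) (δ.b r) -
        phaseSum (fun k => (Q c ((x ∘ skipIdx j) (k + 1)) : ℂ) - Q c ((x ∘ skipIdx j) k))
          (δ.a r))) := by
  have hsum : ∀ r c, ∑ k ∈ Finset.Icc 1 (2 * (n + 1) - 1),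
      (if β.a r ≤ k ∧ k < β.b r then Complex.I ^ k else 0) * (limitMoment n j x ξ k c : ℂ) =
      phaseSum (fun k => (limitMoment n j x ξ k c : ℂ)) (β.b r) -
        phaseSum (fun k => (limitMoment n j x ξ k c : ℂ)) (β.a r) := fun r c =>
    sum_ite_I_pow_mul (β.one_le_a r) (β.a_lt_b r).le (by have := β.b_le r; omega) _
  simp only [hsum]
  have hsucc : ∀ c : Fin n, (fun k => (limitMoment n j x ξ k c.succ : ℂ)) = fun k =>
      ((if k < j then -1 else if k = j then 0 else 1 : ℝ) : ℂ) *
        ((Q c (insertPair j x ξ ξ (k + 1)) : ℂ) - Q c (insertPair j x ξ ξ k)) := by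
    intro c
    funext k
    simp only [limitMoment, Fin.cons_succ, hQ, Complex.ofReal_mul, Complex.ofReal_sub]
  refine det_tie β δ (fun m c => phaseSum (fun k => (limitMoment n j x ξ k c : ℂ)) m)
    (fun m c => phaseSum
      (fun k => (Q c ((x ∘ skipIdx j) (k + 1)) : ℂ) - Q c ((x ∘ skipIdx j) k)) m)
    hj1 hlink hδ (fun m => ?_) (fun c => ?_) (fun m h1 h2 c => ?_)
  · exact phaseSum_ite hj1 _ m
  · simp only [hsucc]
    exact phaseSum_sign_succ fun k => (Q c (insertPair j x ξ ξ k) : ℂ)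
  · simp only [hsucc]
    rw [phaseSum_sign_eq (fun k => (Q c (insertPair j x ξ ξ k) : ℂ)) hj1
      (by rw [insertPair_self, insertPair_succ]) h1 h2]
    simp only [insertPair_skipIdx, Function.comp_apply]

theorem tendsto_coulomb_tie {ι : Type*} {l : Filter ι} {s t : ι → ℝ} {n j : ℕ} {x : ℕ → ℝ} {ξ : ℝ}
    (β : LinkPattern (n + 1)) (δ : LinkPattern n) (hj1 : 1 ≤ j) (hj2 : j ≤ 2 * n + 1)
    (hlink : ¬ β.Linked j (j + 1)) (hδ : IsTieReduction (n + 1) β j δ)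
    (hs : Filter.Tendsto s l (nhds ξ)) (ht : Filter.Tendsto t l (nhds ξ))
    (hch : ∀ᶠ p in l, IsChamber (n + 1) (insertPair j x (s p) (t p)))
    (hy : IsChamber n (x ∘ skipIdx j))
    (hξlo : ∀ i : ℕ, 1 ≤ i → i < j → x i < ξ)
    (hξhi : ∀ k : ℕ, j + 1 < k → k ≤ 2 * (n + 1) → ξ < x k) :
    Filter.Tendsto (fun p => coulomb (n + 1) β (insertPair j x (s p) (t p)) /
        (((t p - s p) ^ ((4 : ℝ)⁻¹) * |Real.log (t p - s p)| : ℝ) : ℂ)) l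
      (nhds (coulomb n δ (x ∘ skipIdx j))) := by
  have hξ : ∀ i ∈ Finset.Icc 1 (2 * n), (x ∘ skipIdx j) i ≠ ξ := by
    intro i hi
    rw [Finset.mem_Icc] at hi
    rw [Function.comp_apply, skipIdx]
    split_ifs with h
    · exact (hξlo i hi.1 h).ne
    · exact (hξhi (i + 2) (by omega) (by omega)).ne'
  have hw : rootWeight n (x ∘ skipIdx j) ξ ≠ 0 := Finset.prod_ne_zero_iff.2 fun i hi =>
    (Real.rpow_pos_of_pos (abs_pos.2 (sub_ne_zero.2 (hξ i hi).symm)) _).ne'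
  choose Q hQ using fun c : Fin n => exists_primitive hy (c : ℕ)
  have key := tendsto_coulomb_insertPair β hj1 hj2 hs ht hch hy hξlo hξhi hξ
  rw [det_limitMoment β δ hj1 hlink hδ Q hQ] at key
  rw [coulomb_eq_det_phaseSum δ hy Q hQ]
  convert key using 2
  conv_rhs =>
    rw [← mul_assoc, ← Complex.ofReal_mul, mul_right_comm, inv_mul_cancel₀ hw, one_mul]

/-- **Logarithmic asymptotics of `F_β` when `{j,j+1} ∉ β`**: as `x_j, x_{j+1} → ξ`,
`F_β(x)/((x_{j+1}−x_j)^{1/4}|log(x_{j+1}−x_j)|) → F_{℘_j(β)/{j,j+1}}(ẍ_j)`. -/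
theorem coulomb_asymptotics_log (N : ℕ) (hN : 1 ≤ N) (β : LinkPattern N) (j : ℕ)
    (hj1 : 1 ≤ j) (hj2 : j ≤ 2 * N - 1) (hlink : ¬ β.Linked j (j + 1))
    (x : ℕ → ℝ) (ξ : ℝ)
    (hx : ∀ i k : ℕ, 1 ≤ i → i < k → k ≤ 2 * N →
      i ≠ j → i ≠ j + 1 → k ≠ j → k ≠ j + 1 → x i < x k)
    (hξlo : ∀ i : ℕ, 1 ≤ i → i < j → x i < ξ)
    (hξhi : ∀ k : ℕ, j + 1 < k → k ≤ 2 * N → ξ < x k)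
    (δ : LinkPattern (N - 1)) (hδ : IsTieReduction N β j δ) :
    Filter.Tendsto
      (fun p : ℝ × ℝ =>
        coulomb N β (Function.update (Function.update x j p.1) (j + 1) p.2) /
          ((((p.2 - p.1) ^ ((4 : ℝ)⁻¹) * |Real.log (p.2 - p.1)| : ℝ)) : ℂ))
      (nhdsWithin (ξ, ξ) {p : ℝ × ℝ | p.1 < p.2 ∧ (∀ i : ℕ, 1 ≤ i → i < j → x i < p.1) ∧
        ∀ k : ℕ, j + 1 < k → k ≤ 2 * N → p.2 < x k})
      (nhds (coulomb (N - 1) δ fun i => if i < j then x i else x (i + 2))) := by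
  obtain ⟨n, rfl⟩ : ∃ n, N = n + 1 := ⟨N - 1, by omega⟩
  have hcomp : (fun i => if i < j then x i else x (i + 2)) = x ∘ skipIdx j := by
    funext i
    rw [Function.comp_apply, skipIdx, apply_ite x]
  rw [hcomp]
  refine tendsto_coulomb_tie (n := n) β δ hj1 (by omega) hlink hδ
    ((continuous_fst.tendsto _).mono_left nhdsWithin_le_nhds)
    ((continuous_snd.tendsto _).mono_left nhdsWithin_le_nhds) ?_ ?_ hξlo hξhi
  · filter_upwards [self_mem_nhdsWithin] with p ⟨hp, hlo, hhi⟩ i k hi hik hk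
    simp only [insertPair_apply]
    split_ifs
    all_goals first
      | omega
      | exact hp
      | exact hhi k (by omega) hk
      | exact hp.trans (hhi k (by omega) hk)
      | exact hlo i hi (by omega)
      | exact (hlo i hi (by omega)).trans hp
      | exact hx i k hi hik hk (by omega) (by omega) (by omega) (by omega)
  · intro i k hi hik hk
    refine hx _ _ ?_ (skipIdx_strictMono j hik) ?_ (skipIdx_ne j i).1 (skipIdx_ne j i).2
      (skipIdx_ne j k).1 (skipIdx_ne j k).2
    · unfold skipIdx; split_ifs <;> omega
    · unfold skipIdx; split_ifs <;> omega
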